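/- Freezing of spins at mesoscopic scales: let N ≥ 2, I = B^N(0,R) for some R > 0, ν ∈ (0,1), and ε > 0. Then for all n sufficiently large there exists a set D̃_n ⊆ D_n with |D_n \ D̃_n| = o(n²) such that for all x, y ∈ D̃_n with |x−y| ≤ n^ν, E_n[ (φ(x)/|φ(x)|) · (φ(y)/|φ(y)|) | Ω^I_{D_n} ] ≥ 1 − ε. -/

import Mathlib

open MeasureTheory Real Filter Asymptotics
open scoped ENNReal NNReal Classical BigOperators

noncomputable section

abbrev Site : Type := ℤ × ℤ

abbrev Spin (N : ℕ) : Type := EuclideanSpace ℝ (Fin N)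

abbrev Conf (N : ℕ) : Type := Site → Spin N

/-- `Λ_n = [-n/2, n/2]² ∩ ℤ²`. -/
def Lam (n : ℕ) : Finset Site :=
  (Finset.Icc (-(n : ℤ)) (n : ℤ) ×ˢ Finset.Icc (-(n : ℤ)) (n : ℤ)).filter
    (fun x => 2 * |x.1| ≤ (n : ℤ) ∧ 2 * |x.2| ≤ (n : ℤ))

/-- extension of a configuration on `Λ_n` by zero (Dirichlet boundary condition). -/
def extZero (n : ℕ) {N : ℕ} (ω : {x // x ∈ Lam n} → Spin N) : Conf N :=
  fun x => if h : x ∈ Lam n then ω ⟨x, h⟩ else 0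

/-- Dirichlet energy `(1/(8π)) Σ_{x∼y} |φ(x) - φ(y)|²`, i.e. coupling `𝔤 = 1/(2π)`;
the sum over the enlarged box `Λ_{n+4}` covers all nearest-neighbour edges meeting
`Λ_n ∪ ∂Λ_n` (edges not meeting `Λ_n` contribute `0` since `φ ≡ 0` there). -/
def dirEnergy (n N : ℕ) (φ : Conf N) : ℝ :=
  (1 / (8 * π)) *
    ∑ x ∈ Lam (n + 4), (‖φ x - φ (x + ((1 : ℤ), (0 : ℤ)))‖ ^ 2 +
      ‖φ x - φ (x + ((0 : ℤ), (1 : ℤ)))‖ ^ 2)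

def gffAux (n N : ℕ) : Measure ({x // x ∈ Lam n} → Spin N) :=
  (Measure.pi fun _ => (volume : Measure (Spin N))).withDensity
    (fun ω => ENNReal.ofReal (Real.exp (- dirEnergy n N (extZero n ω))))

/-- The law `P_n` of the `N`-vectorial Dirichlet GFF on `Λ_n`, viewed as a probability
measure on full configurations (extended by `0` outside `Λ_n`). -/
def gff (n N : ℕ) : Measure (Conf N) :=
  (gffAux n N Set.univ)⁻¹ • (gffAux n N).map (extZero n)

/-- conditional probability `μ[A | B]`. -/
def condProb {α : Type*} [MeasurableSpace α] (μ : Measure α) (B A : Set α) : ℝ≥0∞ :=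
  μ (A ∩ B) / μ B

/-- conditional expectation `E_μ[f | B]`. -/
def condExpOn {α : Type*} [MeasurableSpace α] (μ : Measure α) (B : Set α) (f : α → ℝ) : ℝ :=
  (∫ x in B, f x ∂μ) / (μ B).toReal

/-- `Λ = [-1/2,1/2]²`. -/
def unitSq : Set (ℝ × ℝ) := Set.Icc (-(1/2 : ℝ), -(1/2 : ℝ)) (1/2, 1/2)

/-- `D_n = (nD) ∩ ℤ²`. -/
def Dn (D : Set (ℝ × ℝ)) (n : ℕ) : Set Site :=
  {x | ((x.1 : ℝ) / n, (x.2 : ℝ) / n) ∈ D}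

/-- the event `Ω^I_V = {φ(x) ∉ I ∀ x ∈ V}`. -/
def avoids {N : ℕ} (V : Set Site) (I : Set (Spin N)) : Set (Conf N) :=
  {φ | ∀ x ∈ V, φ x ∉ I}

/-- the closest even integer to `n^α`. -/
def evenSide (n : ℕ) (α : ℝ) : ℤ := 2 * round ((n : ℝ) ^ α / 2)

/-- the discrete box of side length `a` centered at `c`. -/
def boxAt (a : ℤ) (c : Site) : Set Site :=
  {y | 2 * |y.1 - c.1| ≤ a ∧ 2 * |y.2 - c.2| ≤ a}

/-- the inner boundary of the discrete box of side length `a` centered at `c`. -/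
def innerBdryAt (a : ℤ) (c : Site) : Set Site :=
  {y | y ∈ boxAt a c ∧ (2 * |y.1 - c.1| = a ∨ 2 * |y.2 - c.2| = a)}

/-- `c` is a center of a box of `Π_α(x₀)`. -/
def isCenter (D : Set (ℝ × ℝ)) (n : ℕ) (α : ℝ) (x0 : Site) (c : Site) : Prop :=
  (∃ k l : ℤ, c = x0 + (k * evenSide n α, l * evenSide n α)) ∧
    boxAt (evenSide n α) c ⊆ Dn D n

/-- the centers of the boxes of `Π_α(x₀)`, as a finite set. -/
def centersF (D : Set (ℝ × ℝ)) (n : ℕ) (α : ℝ) (x0 : Site) : Finset Site :=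
  (Lam n).filter (fun c => isCenter D n α x0 c)

/-- `⨅_α(x₀)`, the union of the inner boundaries of the boxes of `Π_α(x₀)`. -/
def gridK (D : Set (ℝ × ℝ)) (n : ℕ) (α : ℝ) (x0 : Site) : Set Site :=
  ⋃ c ∈ centersF D n α x0, innerBdryAt (evenSide n α) c

/-- the σ-algebra generated by the coordinates in `K`. -/
def mGrid (N : ℕ) (K : Set Site) : MeasurableSpace (Conf N) :=
  MeasurableSpace.comap (fun φ (y : K) => φ y) inferInstance

/-- the harmonic extension `h^K(c) = E[φ(c) | F_K]` as a random variable. -/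
def harmExt (n N : ℕ) (K : Set Site) (c : Site) : Conf N → Spin N :=
  (gff n N)[fun ψ => ψ c | mGrid N K]

/-- covariance of two real random variables. -/
def covar {α : Type*} [MeasurableSpace α] (μ : Measure α) (X Y : α → ℝ) : ℝ :=
  ∫ ω, (X ω - ∫ ω', X ω' ∂μ) * (Y ω - ∫ ω', Y ω' ∂μ) ∂μ

lemma sq_le_exp_add_exp_neg (y : ℝ) : y ^ 2 ≤ Real.exp y + Real.exp (-y) := by
  have h : |y| ≤ |2 * Real.sinh (y / 2)| := by
    rcases le_total 0 y with hy | hy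
    · have := Real.self_le_sinh_iff.2 (by linarith : 0 ≤ y / 2)
      rw [abs_of_nonneg hy]
      exact le_trans (by linarith) (le_abs_self _)
    · have := Real.sinh_le_self_iff.2 (by linarith : y / 2 ≤ 0)
      rw [abs_of_nonpos hy]
      exact le_trans (by linarith) (neg_le_abs _)
  have h2 := sq_le_sq' (by linarith [abs_nonneg y, abs_nonneg (2 * Real.sinh (y / 2))]) h
  rw [sq_abs, sq_abs, Real.sinh_eq] at h2
  have e1 : Real.exp (y / 2) ^ 2 = Real.exp y := by rw [← Real.exp_nat_mul]; congr 1; push_cast; ring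
  have e2 : Real.exp (-(y / 2)) ^ 2 = Real.exp (-y) := by
    rw [← Real.exp_nat_mul]; congr 1; push_cast; ring
  have e3 : Real.exp (y / 2) * Real.exp (-(y / 2)) = 1 := by rw [← Real.exp_add]; simp
  nlinarith

section GaussianWeight

variable {V : Type*} [NormedAddCommGroup V] [NormedSpace ℝ V]

/-- Symmetric, coercive bilinear forms. -/
def IsCoerciveForm (B : LinearMap.BilinForm ℝ V) : Prop :=
  (∀ v w, B v w = B w v) ∧ ∃ c > 0, ∀ v, c * ‖v‖ ^ 2 ≤ B v v

/-- The unnormalised Gaussian density `exp (-B(v,v))`. -/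
def gaussWeight (B : LinearMap.BilinForm ℝ V) (v : V) : ℝ≥0∞ :=
  ENNReal.ofReal (Real.exp (-(B v v)))

lemma bilinForm_add_self {B : LinearMap.BilinForm ℝ V} (hB : IsCoerciveForm B) (v w : V) :
    B (v + w) (v + w) = B v v + 2 * B v w + B w w := by
  have := hB.1 w v
  simp only [map_add, LinearMap.add_apply]
  linarith

lemma IsCoerciveForm.nonneg {B : LinearMap.BilinForm ℝ V} (hB : IsCoerciveForm B) (v : V) :
    0 ≤ B v v := by
  obtain ⟨c, hc, h⟩ := hB.2
  exact le_trans (by positivity) (h v)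

variable [FiniteDimensional ℝ V]

lemma continuous_bilinForm_self (B : LinearMap.BilinForm ℝ V) : Continuous fun v => B v v := by
  have h : Continuous fun v => LinearMap.toContinuousLinearMap (B v) :=
    (LinearMap.toContinuousLinearMap.toLinearMap ∘ₗ B).continuous_of_finiteDimensional
  exact h.clm_apply continuous_id

/-- Riesz representation of a linear form by a coercive bilinear form. -/
lemma IsCoerciveForm.exists_repr {B : LinearMap.BilinForm ℝ V} (hB : IsCoerciveForm B)
    (l : V →ₗ[ℝ] ℝ) : ∃ k, ∀ v, l v = 2 * B v k := by
  have hinj : Function.Injective B := by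
    rw [← LinearMap.ker_eq_bot, LinearMap.ker_eq_bot']
    intro v hv
    obtain ⟨c, hc, h⟩ := hB.2
    have h1 := h v
    rw [hv] at h1
    simp only [LinearMap.zero_apply] at h1
    have h2 : ‖v‖ ^ 2 ≤ 0 := by
      by_contra hcon
      push Not at hcon
      nlinarith [mul_pos hc hcon]
    have h3 : ‖v‖ = 0 := by nlinarith [norm_nonneg v]
    exact norm_eq_zero.1 h3
  have hsurj : Function.Surjective B :=
    (LinearMap.injective_iff_surjective_of_finrank_eq_finrank
      (Subspace.dual_finrank_eq (K := ℝ) (V := V)).symm).1 hinj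
  obtain ⟨k, hk⟩ := hsurj ((1 / 2 : ℝ) • l)
  refine ⟨k, fun v => ?_⟩
  rw [hB.1, hk]
  simp

variable [MeasurableSpace V] [BorelSpace V]

lemma measurable_gaussWeight (B : LinearMap.BilinForm ℝ V) : Measurable (gaussWeight B) :=
  ((continuous_bilinForm_self B).measurable.neg.exp).ennreal_ofReal

variable (μ : Measure V) [μ.IsAddHaarMeasure]

lemma lintegral_exp_neg_sq_lt_top {c : ℝ} (hc : 0 < c) :
    ∫⁻ v, ENNReal.ofReal (Real.exp (-(c * ‖v‖ ^ 2))) ∂μ < ∞ := by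
  set m : ℕ := Module.finrank ℝ V + 1 with hm
  have hfin := finite_integral_one_add_norm (E := V) (μ := μ) (r := (m : ℝ))
    (by rw [hm]; push_cast; linarith)
  set C : ℝ := Real.exp (1 + 1 / (4 * c)) * (m.factorial : ℝ) with hC
  have hC0 : 0 ≤ C := by positivity
  have key : ∀ v : V, Real.exp (-(c * ‖v‖ ^ 2)) ≤ C * (1 + ‖v‖) ^ (-(m : ℝ)) := by
    intro v
    have hx := norm_nonneg v
    set x := ‖v‖
    have h1 : (1 + x) ^ m / (m.factorial : ℝ) ≤ Real.exp (1 + x) :=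
      Real.pow_div_factorial_le_exp _ (by linarith) m
    have h2 : 1 + x ≤ c * x ^ 2 + (1 + 1 / (4 * c)) := by
      have : c * x ^ 2 + (1 + 1 / (4 * c)) - (1 + x) = (2 * c * x - 1) ^ 2 / (4 * c) := by
        field_simp
        ring
      have h3 : 0 ≤ (2 * c * x - 1) ^ 2 / (4 * c) := by positivity
      linarith
    have hp : 0 < (1 + x) ^ m := by positivity
    have hf : 0 < (m.factorial : ℝ) := by positivity
    rw [Real.rpow_neg (by linarith), Real.rpow_natCast, ← div_eq_mul_inv, le_div_iff₀ hp]
    rw [div_le_iff₀ hf] at h1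
    calc Real.exp (-(c * x ^ 2)) * (1 + x) ^ m
        ≤ Real.exp (-(c * x ^ 2)) * (Real.exp (1 + x) * m.factorial) := by gcongr
      _ ≤ Real.exp (-(c * x ^ 2)) * (Real.exp (c * x ^ 2 + (1 + 1 / (4 * c))) * m.factorial) := by
          gcongr
      _ = C := by
          rw [← mul_assoc, ← Real.exp_add, hC]
          congr 2
          ring
  calc ∫⁻ v, ENNReal.ofReal (Real.exp (-(c * ‖v‖ ^ 2))) ∂μ
      ≤ ∫⁻ v, ENNReal.ofReal C * ENNReal.ofReal ((1 + ‖v‖) ^ (-(m : ℝ))) ∂μ := by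
        refine lintegral_mono fun v => ?_
        rw [← ENNReal.ofReal_mul hC0]
        exact ENNReal.ofReal_le_ofReal (key v)
    _ = ENNReal.ofReal C * ∫⁻ v, ENNReal.ofReal ((1 + ‖v‖) ^ (-(m : ℝ))) ∂μ :=
        lintegral_const_mul' _ _ ENNReal.ofReal_ne_top
    _ < ∞ := ENNReal.mul_lt_top ENNReal.ofReal_lt_top hfin

lemma lintegral_gaussWeight_lt_top {B : LinearMap.BilinForm ℝ V} (hB : IsCoerciveForm B) :
    ∫⁻ v, gaussWeight B v ∂μ < ∞ := by
  obtain ⟨c, hc, h⟩ := hB.2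
  refine lt_of_le_of_lt (lintegral_mono fun v => ?_) (lintegral_exp_neg_sq_lt_top μ hc)
  exact ENNReal.ofReal_le_ofReal (Real.exp_le_exp.2 (neg_le_neg (h v)))

lemma lintegral_gaussWeight_ne_zero (B : LinearMap.BilinForm ℝ V) :
    ∫⁻ v, gaussWeight B v ∂μ ≠ 0 := by
  intro h
  rw [lintegral_eq_zero_iff (measurable_gaussWeight B)] at h
  have hne : NeZero μ := inferInstance
  have : ∀ᵐ v ∂μ, False := by
    filter_upwards [h] with v hv
    have : 0 < gaussWeight B v := ENNReal.ofReal_pos.2 (Real.exp_pos _)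
    simp [hv] at this
  simp at this
  exact hne.out this

/-- Exponential moments of linear forms dominated by the quadratic form. -/
lemma lintegral_exp_linear_le {B : LinearMap.BilinForm ℝ V} (hB : IsCoerciveForm B)
    (l : V →ₗ[ℝ] ℝ) {K : ℝ} (hK0 : 0 ≤ K) (hK : ∀ v, l v ^ 2 ≤ K * B v v) :
    ∫⁻ v, ENNReal.ofReal (Real.exp (l v)) * gaussWeight B v ∂μ
      ≤ ENNReal.ofReal (Real.exp (K / 4)) * ∫⁻ v, gaussWeight B v ∂μ := by
  obtain ⟨k, hk⟩ := hB.exists_repr l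
  have hkk : B k k ≤ K / 4 := by
    have h1 := hK k
    rw [hk k] at h1
    have h0 := hB.nonneg k
    rcases h0.eq_or_lt with h0 | h0
    · rw [← h0]; linarith
    · nlinarith
  have hpt : ∀ v, ENNReal.ofReal (Real.exp (l v)) * gaussWeight B v
      = ENNReal.ofReal (Real.exp (B k k)) * gaussWeight B (v - k) := by
    intro v
    unfold gaussWeight
    rw [← ENNReal.ofReal_mul (Real.exp_pos _).le, ← ENNReal.ofReal_mul (Real.exp_pos _).le,
      ← Real.exp_add, ← Real.exp_add]
    congr 2
    have h2 := hB.1 k v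
    simp only [map_sub, LinearMap.sub_apply]
    rw [hk v]
    linarith
  simp_rw [hpt]
  rw [lintegral_const_mul' _ _ ENNReal.ofReal_ne_top, lintegral_sub_right_eq_self]
  gcongr

/-- Second moments of linear forms dominated by the quadratic form. -/
lemma lintegral_sq_linear_le {B : LinearMap.BilinForm ℝ V} (hB : IsCoerciveForm B)
    (l : V →ₗ[ℝ] ℝ) {K : ℝ} (hK0 : 0 < K) (hK : ∀ v, l v ^ 2 ≤ K * B v v) :
    ∫⁻ v, ENNReal.ofReal (l v ^ 2) * gaussWeight B v ∂μ
      ≤ ENNReal.ofReal (4 * K) * ∫⁻ v, gaussWeight B v ∂μ := by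
  have hs : 0 < √K := Real.sqrt_pos.2 hK0
  have hss : √K ^ 2 = K := Real.sq_sqrt hK0.le
  have hsc : ∀ (a : ℝ), a ^ 2 = 1 → ∀ v, ((a / √K) • l) v ^ 2 ≤ 1 * B v v := by
    intro a ha v
    simp only [LinearMap.smul_apply, smul_eq_mul]
    rw [mul_pow, div_pow, ha, hss, one_mul, div_mul_eq_mul_div, one_mul, div_le_iff₀ hK0]
    linarith [hK v]
  have h1 := lintegral_exp_linear_le μ hB ((1 / √K) • l) zero_le_one (hsc 1 (by norm_num))
  have h2 := lintegral_exp_linear_le μ hB ((-1 / √K) • l) zero_le_one (hsc (-1) (by norm_num))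
  have hmeas : ∀ a : ℝ, Measurable fun v =>
      ENNReal.ofReal (Real.exp ((a • l) v)) * gaussWeight B v := fun a =>
    (((a • l).continuous_of_finiteDimensional.measurable.exp).ennreal_ofReal).mul
      (measurable_gaussWeight B)
  have hexp : Real.exp (1 / 4) ≤ 2 := by
    have h := Real.add_one_le_exp (-(1 / 4 : ℝ))
    have h' : Real.exp (1 / 4) * Real.exp (-(1 / 4)) = 1 := by
      rw [← Real.exp_add]; norm_num
    nlinarith [Real.exp_pos (1 / 4)]
  calc ∫⁻ v, ENNReal.ofReal (l v ^ 2) * gaussWeight B v ∂μ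
      ≤ ∫⁻ v, ENNReal.ofReal K * (ENNReal.ofReal (Real.exp (((1 / √K) • l) v)) * gaussWeight B v
          + ENNReal.ofReal (Real.exp (((-1 / √K) • l) v)) * gaussWeight B v) ∂μ := by
        refine lintegral_mono fun v => ?_
        rw [← add_mul, ← mul_assoc, ← ENNReal.ofReal_add (Real.exp_pos _).le (Real.exp_pos _).le,
          ← ENNReal.ofReal_mul hK0.le]
        gcongr
        simp only [LinearMap.smul_apply, smul_eq_mul]
        have hx : -1 / √K * l v = -(1 / √K * l v) := by ring
        rw [hx]
        set y := 1 / √K * l v with hy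
        have hly : l v ^ 2 = K * y ^ 2 := by
          rw [hy, mul_pow, div_pow, hss]
          field_simp
        rw [hly]
        gcongr
        exact sq_le_exp_add_exp_neg y
    _ = ENNReal.ofReal K * (∫⁻ v, ENNReal.ofReal (Real.exp (((1 / √K) • l) v)) * gaussWeight B v ∂μ
          + ∫⁻ v, ENNReal.ofReal (Real.exp (((-1 / √K) • l) v)) * gaussWeight B v ∂μ) := by
        rw [lintegral_const_mul' _ _ ENNReal.ofReal_ne_top, lintegral_add_left (hmeas _)]
    _ ≤ ENNReal.ofReal K * (ENNReal.ofReal 2 * ∫⁻ v, gaussWeight B v ∂μ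
          + ENNReal.ofReal 2 * ∫⁻ v, gaussWeight B v ∂μ) := by
        gcongr
        · exact h1.trans (by gcongr)
        · exact h2.trans (by gcongr)
    _ = ENNReal.ofReal (4 * K) * ∫⁻ v, gaussWeight B v ∂μ := by
        rw [← add_mul, ← mul_assoc, ← ENNReal.ofReal_add (by norm_num) (by norm_num),
          ← ENNReal.ofReal_mul hK0.le]
        congr 2
        ring

/-- Exponential moments of a sum of squares of linear forms. -/
lemma lintegral_exp_sum_sq_le {B : LinearMap.BilinForm ℝ V} (hB : IsCoerciveForm B)
    {J : Type*} (s : Finset J) (l : J → V →ₗ[ℝ] ℝ) {K t : ℝ} (hK0 : 0 < K) (ht : 0 < t)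
    (hK : ∀ j ∈ s, ∀ v, l j v ^ 2 ≤ K * B v v)
    (hF : ∀ v, t * ∑ j ∈ s, l j v ^ 2 ≤ B v v / 2) :
    ∫⁻ v, ENNReal.ofReal (Real.exp (t * ∑ j ∈ s, l j v ^ 2)) * gaussWeight B v ∂μ
      ≤ ENNReal.ofReal (Real.exp (8 * t * K * s.card)) * ∫⁻ v, gaussWeight B v ∂μ := by
  set Bt : LinearMap.BilinForm ℝ V :=
    B - t • ∑ j ∈ s, (LinearMap.mul ℝ ℝ).compl₁₂ (l j) (l j) with hBt
  have hBtv : ∀ v w, Bt v w = B v w - t * ∑ j ∈ s, l j v * l j w := by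
    intro v w
    simp [hBt, LinearMap.sum_apply]
  have hBtself : ∀ v, Bt v v = B v v - t * ∑ j ∈ s, l j v ^ 2 := by
    intro v
    simp only [hBtv, sq]
  have hBtc : IsCoerciveForm Bt := by
    refine ⟨fun v w => ?_, ?_⟩
    · rw [hBtv, hBtv, hB.1 v w]
      simp only [mul_comm]
    · obtain ⟨c, hc, h⟩ := hB.2
      refine ⟨c / 2, by positivity, fun v => ?_⟩
      rw [hBtself]
      linarith [h v, hF v]
  have hW : ∀ v, ENNReal.ofReal (Real.exp (t * ∑ j ∈ s, l j v ^ 2)) * gaussWeight B v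
      = gaussWeight Bt v := by
    intro v
    unfold gaussWeight
    rw [← ENNReal.ofReal_mul (Real.exp_pos _).le, ← Real.exp_add, hBtself]
    congr 2
    ring
  simp_rw [hW]
  set m : ℝ := 8 * t * K * s.card with hm
  have hm0 : 0 ≤ m := by positivity
  set Zt := ∫⁻ v, gaussWeight Bt v ∂μ with hZt
  have hZtfin : Zt ≠ ∞ := (lintegral_gaussWeight_lt_top μ hBtc).ne
  have hmeas : ∀ j, Measurable fun v => ENNReal.ofReal (l j v ^ 2) * gaussWeight Bt v := fun j =>
    ((((l j).continuous_of_finiteDimensional.measurable).pow_const 2).ennreal_ofReal).mul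
      (measurable_gaussWeight Bt)
  have hmean : ∫⁻ v, ENNReal.ofReal (t * ∑ j ∈ s, l j v ^ 2) * gaussWeight Bt v ∂μ
      ≤ ENNReal.ofReal m * Zt := by
    have hpt : ∀ v, ENNReal.ofReal (t * ∑ j ∈ s, l j v ^ 2) * gaussWeight Bt v
        = ENNReal.ofReal t * ∑ j ∈ s, ENNReal.ofReal (l j v ^ 2) * gaussWeight Bt v := by
      intro v
      rw [ENNReal.ofReal_mul ht.le, ENNReal.ofReal_sum_of_nonneg (fun _ _ => sq_nonneg _),
        mul_assoc, Finset.sum_mul]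
    simp_rw [hpt]
    rw [lintegral_const_mul' _ _ ENNReal.ofReal_ne_top,
      lintegral_finsetSum _ (fun j _ => hmeas j)]
    calc ENNReal.ofReal t * ∑ j ∈ s, ∫⁻ v, ENNReal.ofReal (l j v ^ 2) * gaussWeight Bt v ∂μ
        ≤ ENNReal.ofReal t * ∑ j ∈ s, ENNReal.ofReal (4 * (2 * K)) * Zt := by
          gcongr with j hj
          refine lintegral_sq_linear_le μ hBtc (l j) (by positivity) fun v => ?_
          rw [hBtself]
          nlinarith [hK j hj v, hF v]
      _ = ENNReal.ofReal m * Zt := by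
          rw [Finset.sum_const, nsmul_eq_mul, ← mul_assoc, ← mul_assoc, ← ENNReal.ofReal_natCast,
            ← ENNReal.ofReal_mul ht.le, ← ENNReal.ofReal_mul (by positivity)]
          congr 2
          rw [hm]; ring
  have htan : ENNReal.ofReal (1 + m) * Zt
      ≤ ENNReal.ofReal (Real.exp m) * (∫⁻ v, gaussWeight B v ∂μ) + ENNReal.ofReal m * Zt := by
    calc ENNReal.ofReal (1 + m) * Zt
        = ∫⁻ v, ENNReal.ofReal (1 + m) * gaussWeight Bt v ∂μ :=
          (lintegral_const_mul' _ _ ENNReal.ofReal_ne_top).symm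
      _ ≤ ∫⁻ v, ENNReal.ofReal (Real.exp m) * gaussWeight B v
            + ENNReal.ofReal (t * ∑ j ∈ s, l j v ^ 2) * gaussWeight Bt v ∂μ := by
          refine lintegral_mono fun v => ?_
          have hS : 0 ≤ t * ∑ j ∈ s, l j v ^ 2 :=
            mul_nonneg ht.le (Finset.sum_nonneg fun _ _ => sq_nonneg _)
          unfold gaussWeight
          rw [← ENNReal.ofReal_mul (by positivity), ← ENNReal.ofReal_mul (by positivity),
            ← ENNReal.ofReal_mul hS, ← ENNReal.ofReal_add (by positivity) (by positivity)]
          apply ENNReal.ofReal_le_ofReal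
          rw [hBtself]
          set S := t * ∑ j ∈ s, l j v ^ 2
          have h1 : Real.exp m * Real.exp (-(B v v))
              = Real.exp (m - S) * Real.exp (-(B v v - S)) := by
            rw [← Real.exp_add, ← Real.exp_add]; congr 1; ring
          rw [h1, ← add_mul]
          refine mul_le_mul_of_nonneg_right ?_ (Real.exp_pos _).le
          linarith [Real.add_one_le_exp (m - S)]
      _ = ENNReal.ofReal (Real.exp m) * (∫⁻ v, gaussWeight B v ∂μ)
            + ∫⁻ v, ENNReal.ofReal (t * ∑ j ∈ s, l j v ^ 2) * gaussWeight Bt v ∂μ := by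
          rw [lintegral_add_left ((measurable_gaussWeight B).const_mul _),
            lintegral_const_mul' _ _ ENNReal.ofReal_ne_top]
      _ ≤ _ := by gcongr
  rw [ENNReal.ofReal_add zero_le_one hm0, ENNReal.ofReal_one, add_mul, one_mul] at htan
  exact (ENNReal.add_le_add_iff_right (ENNReal.mul_ne_top ENNReal.ofReal_ne_top hZtfin)).1 htan

end GaussianWeight

/-- Entropy inequality for a finite measure restricted to `s`. -/
lemma setLIntegral_le_of_exp {α : Type*} [MeasurableSpace α] {ρ : Measure α} [IsFiniteMeasure ρ]
    {s : Set α} {F : α → ℝ} (hF : Measurable F) (hF0 : ∀ a, 0 ≤ F a) {A : ℝ} (hA : 0 ≤ A)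
    (h : ∫⁻ a in s, ENNReal.ofReal (Real.exp (F a)) ∂ρ ≤ ENNReal.ofReal (Real.exp A) * ρ s) :
    ∫⁻ a in s, ENNReal.ofReal (F a) ∂ρ ≤ ENNReal.ofReal A * ρ s := by
  have hpt : ∀ a, ENNReal.ofReal (F a) + 1 ≤ ENNReal.ofReal A
      + ENNReal.ofReal (Real.exp (-A)) * ENNReal.ofReal (Real.exp (F a)) := by
    intro a
    rw [← ENNReal.ofReal_mul (Real.exp_pos _).le, ← ENNReal.ofReal_one,
      ← ENNReal.ofReal_add (hF0 a) zero_le_one, ← ENNReal.ofReal_add hA (by positivity),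
      ← Real.exp_add]
    apply ENNReal.ofReal_le_ofReal
    linarith [Real.add_one_le_exp (-A + F a)]
  have hint : (∫⁻ a in s, ENNReal.ofReal (F a) ∂ρ) + ρ s ≤ ENNReal.ofReal A * ρ s + ρ s := by
    calc (∫⁻ a in s, ENNReal.ofReal (F a) ∂ρ) + ρ s
        = ∫⁻ a in s, (ENNReal.ofReal (F a) + 1) ∂ρ := by
          rw [lintegral_add_left hF.ennreal_ofReal]; simp
      _ ≤ ∫⁻ a in s, (ENNReal.ofReal A
            + ENNReal.ofReal (Real.exp (-A)) * ENNReal.ofReal (Real.exp (F a))) ∂ρ :=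
          lintegral_mono hpt
      _ = ENNReal.ofReal A * ρ s + ENNReal.ofReal (Real.exp (-A))
            * ∫⁻ a in s, ENNReal.ofReal (Real.exp (F a)) ∂ρ := by
          rw [lintegral_add_left measurable_const,
            lintegral_const_mul' _ _ ENNReal.ofReal_ne_top]
          simp
      _ ≤ ENNReal.ofReal A * ρ s + ENNReal.ofReal (Real.exp (-A))
            * (ENNReal.ofReal (Real.exp A) * ρ s) := by gcongr
      _ = _ := by
          rw [← mul_assoc, ← ENNReal.ofReal_mul (Real.exp_pos _).le, ← Real.exp_add]
          simp
  exact (ENNReal.add_le_add_iff_right (measure_ne_top ρ s)).1 hint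

section Resampling

variable {V : Type*} [NormedAddCommGroup V] [NormedSpace ℝ V]

lemma gaussWeight_add_add_gaussWeight_sub_ge {B : LinearMap.BilinForm ℝ V}
    (hB : IsCoerciveForm B) (v k : V) :
    2 * (ENNReal.ofReal (Real.exp (-(B k k))) * gaussWeight B v)
      ≤ gaussWeight B (v + k) + gaussWeight B (-v + k) := by
  unfold gaussWeight
  rw [← ENNReal.ofReal_mul (Real.exp_pos _).le, ← ENNReal.ofReal_add (Real.exp_pos _).le
    (Real.exp_pos _).le, show (2 : ℝ≥0∞) = ENNReal.ofReal 2 by simp,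
    ← ENNReal.ofReal_mul (by norm_num)]
  apply ENNReal.ofReal_le_ofReal
  rw [bilinForm_add_self hB, bilinForm_add_self hB]
  simp only [map_neg, LinearMap.neg_apply, neg_neg]
  set b := B v k
  have e1 : Real.exp (-(B v v + 2 * b + B k k))
      = Real.exp (-(B k k)) * Real.exp (-(B v v)) * Real.exp (-(2 * b)) := by
    rw [← Real.exp_add, ← Real.exp_add]; congr 1; ring
  have e2 : Real.exp (-(B v v + 2 * -b + B k k))
      = Real.exp (-(B k k)) * Real.exp (-(B v v)) * Real.exp (2 * b) := by
    rw [← Real.exp_add, ← Real.exp_add]; congr 1; ring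
  rw [e1, e2]
  have hp : 0 < Real.exp (-(B k k)) * Real.exp (-(B v v)) := by positivity
  nlinarith [Real.add_one_le_exp (2 * b), Real.add_one_le_exp (-(2 * b))]

variable [FiniteDimensional ℝ V] [MeasurableSpace V] [BorelSpace V] (μ : Measure V)
  [μ.IsAddHaarMeasure]

/-- Lower bound on the Gaussian mass of a set containing a translate of a symmetric set. -/
lemma setLIntegral_gaussWeight_shift_ge {B : LinearMap.BilinForm ℝ V} (hB : IsCoerciveForm B)
    {A O : Set V} (hA : MeasurableSet A) (hO : MeasurableSet O) (hsymm : ∀ v ∈ A, -v ∈ A)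
    (k : V) (hk : ∀ v ∈ A, v + k ∈ O) :
    ENNReal.ofReal (Real.exp (-(B k k))) * ∫⁻ v in A, gaussWeight B v ∂μ
      ≤ ∫⁻ v in O, gaussWeight B v ∂μ := by
  have hW := measurable_gaussWeight B
  have h1 : ∫⁻ v in A, gaussWeight B (v + k) ∂μ ≤ ∫⁻ v in O, gaussWeight B v ∂μ := by
    rw [← lintegral_indicator hO, ← lintegral_indicator hA,
      ← lintegral_add_right_eq_self (O.indicator (gaussWeight B)) k]
    refine lintegral_mono fun v => ?_
    by_cases hv : v ∈ A
    · simp [hv, hk v hv]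
    · simp [hv]
  have h2 : ∫⁻ v in A, gaussWeight B (-v + k) ∂μ = ∫⁻ v in A, gaussWeight B (v + k) ∂μ := by
    rw [← lintegral_indicator hA, ← lintegral_indicator hA,
      ← lintegral_neg_eq_self (μ := μ) (A.indicator fun v => gaussWeight B (v + k))]
    refine lintegral_congr fun v => ?_
    by_cases hv : v ∈ A
    · simp [hv, hsymm v hv]
    · have : -v ∉ A := fun h => hv (by simpa using hsymm _ h)
      simp [hv, this]
  have h3 : 2 * (ENNReal.ofReal (Real.exp (-(B k k))) * ∫⁻ v in A, gaussWeight B v ∂μ)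
      ≤ 2 * ∫⁻ v in A, gaussWeight B (v + k) ∂μ := by
    calc 2 * (ENNReal.ofReal (Real.exp (-(B k k))) * ∫⁻ v in A, gaussWeight B v ∂μ)
        = ∫⁻ v in A, 2 * (ENNReal.ofReal (Real.exp (-(B k k))) * gaussWeight B v) ∂μ := by
          rw [lintegral_const_mul' _ _ (by simp), lintegral_const_mul' _ _ ENNReal.ofReal_ne_top]
      _ ≤ ∫⁻ v in A, gaussWeight B (v + k) + gaussWeight B (-v + k) ∂μ :=
          lintegral_mono fun v => gaussWeight_add_add_gaussWeight_sub_ge hB v k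
      _ = 2 * ∫⁻ v in A, gaussWeight B (v + k) ∂μ := by
          rw [lintegral_add_left (f := fun v => gaussWeight B (v + k))
            (hW.comp (measurable_id.add_const k)), h2, two_mul]
  exact ((ENNReal.mul_le_mul_iff_right (by simp) (by simp)).1 h3).trans h1

variable {E : Type*} [NormedAddCommGroup E] [InnerProductSpace ℝ E] [FiniteDimensional ℝ E]
  [MeasurableSpace E] [BorelSpace E]

/-- Radial Gaussian density on `E`. -/
def radialWeight (e : ℝ) (z : E) : ℝ≥0∞ := ENNReal.ofReal (Real.exp (-(e * ‖z‖ ^ 2)))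

lemma measurable_radialWeight {F : Type*} [NormedAddCommGroup F] [MeasurableSpace F]
    [BorelSpace F] (e : ℝ) : Measurable (radialWeight (E := F) e) := by
  unfold radialWeight
  fun_prop

lemma lintegral_radialWeight_ne_top {e : ℝ} (he : 0 < e) :
    ∫⁻ z : E, radialWeight e z ≠ ∞ :=
  (lintegral_exp_neg_sq_lt_top (volume : Measure E) he).ne

lemma lintegral_radialWeight_ne_zero (e : ℝ) : ∫⁻ z : E, radialWeight e z ≠ 0 := by
  intro h
  rw [lintegral_eq_zero_iff (measurable_radialWeight e)] at h
  have hne : NeZero (volume : Measure E) := inferInstance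
  have : ∀ᵐ v : E, False := by
    filter_upwards [h] with v hv
    have : 0 < radialWeight e v := ENNReal.ofReal_pos.2 (Real.exp_pos _)
    simp [hv] at this
  simp at this
  exact hne.out this

/-- `k` embeds `E` into `V` and `Z` is the associated Gaussian coordinate. -/
structure IsGaussCoord (B : LinearMap.BilinForm ℝ V) (e : ℝ) (k : E →ₗ[ℝ] V) (Z : V →ₗ[ℝ] E) :
    Prop where
  pairing : ∀ v z, B v (k z) = e * inner ℝ (Z v) z
  coord : ∀ z, Z (k z) = z

lemma IsGaussCoord.weight_eq {W F : Type*} [NormedAddCommGroup W] [NormedSpace ℝ W]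
    [NormedAddCommGroup F] [InnerProductSpace ℝ F] {B : LinearMap.BilinForm ℝ W}
    (hB : IsCoerciveForm B) {e : ℝ} {k : F →ₗ[ℝ] W} {Z : W →ₗ[ℝ] F} (h : IsGaussCoord B e k Z)
    (v : W) (z : F) :
    gaussWeight B (v + k z) * radialWeight e (Z v)
      = gaussWeight B v * radialWeight e (Z v + z) := by
  unfold gaussWeight radialWeight
  rw [← ENNReal.ofReal_mul (Real.exp_pos _).le, ← ENNReal.ofReal_mul (Real.exp_pos _).le,
    ← Real.exp_add, ← Real.exp_add, bilinForm_add_self hB, h.pairing, h.pairing, h.coord,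
    norm_add_sq_real, real_inner_self_eq_norm_sq]
  congr 2
  ring

/-- Conditioning on the complement of one Gaussian coordinate. -/
lemma lintegral_resample_le {B : LinearMap.BilinForm ℝ V} (hB : IsCoerciveForm B) {e : ℝ}
    (he : 0 < e) {k : E →ₗ[ℝ] V} {Z : V →ₗ[ℝ] E} (h : IsGaussCoord B e k Z)
    {G U : V → ℝ≥0∞} (hG : Measurable G) (hU : Measurable U) (hGinv : ∀ v z, G (v + k z) = G v)
    {A : ℝ≥0∞} (hA : ∀ v, ∫⁻ z, radialWeight e z * U (v - k (Z v) + k z)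
      ≤ A * ∫⁻ z : E, radialWeight e z) :
    ∫⁻ v, gaussWeight B v * (G v * U v) ∂μ ≤ A * ∫⁻ v, gaussWeight B v * G v ∂μ := by
  set C := ∫⁻ z : E, radialWeight e z with hC
  have hC0 : C ≠ 0 := lintegral_radialWeight_ne_zero e
  have hCtop : C ≠ ∞ := lintegral_radialWeight_ne_top he
  have hW := measurable_gaussWeight B
  have hγ := measurable_radialWeight (F := E) e
  have hZ : Measurable Z := Z.continuous_of_finiteDimensional.measurable
  have hkm : Measurable k := k.continuous_of_finiteDimensional.measurable
  have hmain : (∫⁻ v, gaussWeight B v * (G v * U v) ∂μ) * C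
      = ∫⁻ v, gaussWeight B v * G v * (∫⁻ z : E, radialWeight e z * U (v - k (Z v) + k z)) ∂μ := by
    calc (∫⁻ v, gaussWeight B v * (G v * U v) ∂μ) * C
        = ∫⁻ v, (∫⁻ z, gaussWeight B v * (G v * U v) * radialWeight e (Z v - z)) ∂μ := by
          rw [← lintegral_mul_const' _ _ hCtop]
          refine lintegral_congr fun v => ?_
          rw [lintegral_const_mul (f := fun z => radialWeight e (Z v - z)) _
            (hγ.comp (measurable_const.sub measurable_id)),
            lintegral_sub_left_eq_self (radialWeight e) (Z v)]
      _ = ∫⁻ z, (∫⁻ v, gaussWeight B v * (G v * U v) * radialWeight e (Z v - z) ∂μ) := by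
          refine lintegral_lintegral_swap (Measurable.aemeasurable ?_)
          exact ((hW.mul (hG.mul hU)).comp measurable_fst).mul
            (hγ.comp ((hZ.comp measurable_fst).sub measurable_snd))
      _ = ∫⁻ z, (∫⁻ v, gaussWeight B (v + k z) * (G v * U (v + k z)) * radialWeight e (Z v) ∂μ) := by
          refine lintegral_congr fun z => ?_
          rw [← lintegral_add_right_eq_self _ (k z)]
          refine lintegral_congr fun v => ?_
          rw [hGinv, map_add, h.coord, add_sub_cancel_right]
      _ = ∫⁻ z, (∫⁻ v, gaussWeight B v * G v * (radialWeight e (Z v + z) * U (v + k z)) ∂μ) := by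
          refine lintegral_congr fun z => lintegral_congr fun v => ?_
          rw [mul_right_comm, h.weight_eq hB]
          ring
      _ = ∫⁻ v, (∫⁻ z, gaussWeight B v * G v * (radialWeight e (Z v + z) * U (v + k z))) ∂μ := by
          refine (lintegral_lintegral_swap (Measurable.aemeasurable ?_)).symm
          exact ((hW.mul hG).comp measurable_fst).mul
            ((hγ.comp ((hZ.comp measurable_fst).add measurable_snd)).mul
              (hU.comp (measurable_fst.add (hkm.comp measurable_snd))))
      _ = _ := by
          refine lintegral_congr fun v => ?_
          rw [lintegral_const_mul (f := fun z => radialWeight e (Z v + z) * U (v + k z)) _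
            ((hγ.comp (measurable_id.const_add _)).mul
            (hU.comp (hkm.const_add _)))]
          congr 1
          rw [← lintegral_add_left_eq_self (fun z => radialWeight e z * U (v - k (Z v) + k z)) (Z v)]
          refine lintegral_congr fun z => ?_
          rw [map_add]
          congr 2
          abel
  have hle : (∫⁻ v, gaussWeight B v * (G v * U v) ∂μ) * C
      ≤ (A * ∫⁻ v, gaussWeight B v * G v ∂μ) * C := by
    rw [hmain]
    calc ∫⁻ v, gaussWeight B v * G v * (∫⁻ z : E, radialWeight e z * U (v - k (Z v) + k z)) ∂μ
        ≤ ∫⁻ v, gaussWeight B v * G v * (A * C) ∂μ := by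
          refine lintegral_mono fun v => ?_
          gcongr
          exact hA v
      _ = _ := by
          rw [lintegral_mul_const (f := fun v => gaussWeight B v * G v) _ (hW.mul hG)]
          ring
  exact (ENNReal.mul_le_mul_iff_left hC0 hCtop).1 hle

lemma lintegral_prod_resample_le {B : LinearMap.BilinForm ℝ V} (hB : IsCoerciveForm B) {e : ℝ}
    (he : 0 < e) {J : Type*} (s : Finset J) {k : J → E →ₗ[ℝ] V} {Z : J → V →ₗ[ℝ] E}
    (h : ∀ j ∈ s, IsGaussCoord B e (k j) (Z j)) {U : J → V → ℝ≥0∞} (hU : ∀ j, Measurable (U j))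
    (hinv : ∀ i ∈ s, ∀ j ∈ s, i ≠ j → ∀ v z, U i (v + k j z) = U i v) {A : ℝ≥0∞}
    (hA : ∀ j ∈ s, ∀ v, ∫⁻ z, radialWeight e z * U j (v - k j (Z j v) + k j z)
      ≤ A * ∫⁻ z : E, radialWeight e z) :
    ∫⁻ v, gaussWeight B v * ∏ j ∈ s, U j v ∂μ ≤ A ^ s.card * ∫⁻ v, gaussWeight B v ∂μ := by
  induction s using Finset.induction_on with
  | empty => simp
  | insert j s hj ih =>
    have hmem : ∀ i ∈ s, i ∈ insert j s := fun i hi => Finset.mem_insert_of_mem hi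
    have ih' := ih (fun i hi => h i (hmem i hi))
      (fun i hi i' hi' => hinv i (hmem i hi) i' (hmem i' hi')) (fun i hi => hA i (hmem i hi))
    have hjm := Finset.mem_insert_self j s
    have hstep := lintegral_resample_le μ hB he (h j hjm) (G := fun v => ∏ i ∈ s, U i v)
      (U := U j) (Finset.measurable_prod _ fun i _ => hU i) (hU j) (fun v z =>
        Finset.prod_congr rfl fun i hi =>
          hinv i (hmem i hi) j hjm (fun hij => hj (hij ▸ hi)) v z) (hA j hjm)
    rw [Finset.card_insert_of_notMem hj, pow_succ']
    simp_rw [Finset.prod_insert hj, mul_comm (U j _)]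
    calc _ ≤ _ := hstep
      _ ≤ A * (A ^ s.card * ∫⁻ v, gaussWeight B v ∂μ) := by gcongr
      _ = _ := by ring

end Resampling

section Lattice

lemma mem_Lam {n : ℕ} {x : Site} : x ∈ Lam n ↔ 2 * |x.1| ≤ (n : ℤ) ∧ 2 * |x.2| ≤ (n : ℤ) := by
  simp only [Lam, Finset.mem_filter, Finset.mem_product, Finset.mem_Icc]
  constructor
  · exact fun h => h.2
  · intro h
    have h1 := abs_nonneg x.1
    have h2 := abs_nonneg x.2
    have h3 := abs_le.1 (show |x.1| ≤ (n : ℤ) by linarith [h.1])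
    have h4 := abs_le.1 (show |x.2| ≤ (n : ℤ) by linarith [h.2])
    exact ⟨⟨h3, h4⟩, h⟩

lemma mem_Lam_iff {n : ℕ} {x : Site} : x ∈ Lam n ↔
    (-(n : ℤ) ≤ 2 * x.1 ∧ 2 * x.1 ≤ n) ∧ -(n : ℤ) ≤ 2 * x.2 ∧ 2 * x.2 ≤ n := by
  rw [mem_Lam, ← abs_two (α := ℤ), ← abs_mul, ← abs_mul, abs_le, abs_le, abs_two]

variable {N : ℕ}

/-- Squared norm of the discrete gradient at `x`. -/
def gradSq (φ : Conf N) (x : Site) : ℝ :=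
  ‖φ x - φ (x + ((1 : ℤ), (0 : ℤ)))‖ ^ 2 + ‖φ x - φ (x + ((0 : ℤ), (1 : ℤ)))‖ ^ 2

/-- `φ` vanishes outside `Λ_n`. -/
def VanishesOff (n : ℕ) (φ : Conf N) : Prop := ∀ x ∉ Lam n, φ x = 0

lemma gradSq_nonneg (φ : Conf N) (x : Site) : 0 ≤ gradSq φ x := by
  unfold gradSq; positivity

lemma sum_gradSq_eq (n : ℕ) (φ : Conf N) :
    ∑ x ∈ Lam (n + 4), gradSq φ x = 8 * π * dirEnergy n N φ := by
  unfold dirEnergy gradSq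
  field_simp

lemma dirEnergy_nonneg (n : ℕ) (φ : Conf N) : 0 ≤ dirEnergy n N φ := by
  unfold dirEnergy
  have : 0 < π := Real.pi_pos
  positivity

lemma VanishesOff.gradSq_eq_zero {n : ℕ} {φ : Conf N} (h : VanishesOff n φ) {x : Site}
    (hx : x ∉ Lam (n + 4)) : gradSq φ x = 0 := by
  have h0 : φ x = 0 := h x fun hx' => hx (by
    rw [mem_Lam_iff] at *
    push_cast
    omega)
  have h1 : φ (x + (1, 0)) = 0 := h _ fun hx' => hx (by
    rw [mem_Lam_iff] at *
    simp only [Prod.fst_add, Prod.snd_add, add_zero] at hx'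
    push_cast
    omega)
  have h2 : φ (x + (0, 1)) = 0 := h _ fun hx' => hx (by
    rw [mem_Lam_iff] at *
    simp only [Prod.fst_add, Prod.snd_add, add_zero] at hx'
    push_cast
    omega)
  simp [gradSq, h0, h1, h2]

lemma VanishesOff.sum_gradSq_le {n : ℕ} {φ : Conf N} (h : VanishesOff n φ) {J : Type*}
    (s : Finset J) (g : J → Site) (hg : Set.InjOn g s) :
    ∑ j ∈ s, gradSq φ (g j) ≤ 8 * π * dirEnergy n N φ := by
  rw [← sum_gradSq_eq, ← Finset.sum_image (f := gradSq φ) hg]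
  calc ∑ x ∈ s.image g, gradSq φ x
      ≤ ∑ x ∈ s.image g ∪ Lam (n + 4), gradSq φ x :=
        Finset.sum_le_sum_of_subset_of_nonneg Finset.subset_union_left
          fun _ _ _ => gradSq_nonneg _ _
    _ = ∑ x ∈ Lam (n + 4), gradSq φ x :=
        (Finset.sum_subset Finset.subset_union_right fun x _ hx => h.gradSq_eq_zero hx).symm

/-- Average of `φ` over the antidiagonal at distance `k` from `x`. -/
def diagAvg (φ : Conf N) (x : Site) (k : ℕ) : Spin N :=
  ((k : ℝ) + 1)⁻¹ • ∑ i ∈ Finset.range (k + 1), φ (x + ((i : ℤ), (k : ℤ) - i))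

lemma diagAvg_sub_diagAvg_succ (φ : Conf N) (x : Site) (k : ℕ) :
    diagAvg φ x k - diagAvg φ x (k + 1) = (((k : ℝ) + 1) * (k + 2))⁻¹ •
      ∑ i ∈ Finset.range (k + 1),
        (((i : ℝ) + 1) • (φ (x + ((i : ℤ), (k : ℤ) - i))
            - φ (x + ((i : ℤ), (k : ℤ) - i) + (1, 0)))
          + ((k : ℝ) + 1 - i) • (φ (x + ((i : ℤ), (k : ℤ) - i))
            - φ (x + ((i : ℤ), (k : ℤ) - i) + (0, 1)))) := by
  set b : ℕ → Spin N := fun j => φ (x + ((j : ℤ), ((k + 1 : ℕ) : ℤ) - j)) with hb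
  have hb1 : ∀ i : ℕ, φ (x + ((i : ℤ), (k : ℤ) - i) + (1, 0)) = b (i + 1) := by
    intro i
    simp only [hb]
    congr 1
    ext <;> simp
    ring
  have hb2 : ∀ i : ℕ, φ (x + ((i : ℤ), (k : ℤ) - i) + (0, 1)) = b i := by
    intro i
    simp only [hb]
    congr 1
    ext <;> simp
    ring
  have hsum1 : ∑ i ∈ Finset.range (k + 1), ((i : ℝ) + 1) • b (i + 1)
      = ∑ j ∈ Finset.range (k + 2), (j : ℝ) • b j := by
    rw [Finset.sum_range_succ' _ (k + 1)]
    simp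
  have hsum2 : ∑ i ∈ Finset.range (k + 1), ((k : ℝ) + 1 - i) • b i
      = ∑ j ∈ Finset.range (k + 2), ((k : ℝ) + 1 - j) • b j := by
    rw [Finset.sum_range_succ _ (k + 1)]
    simp
  have hsum : ∑ i ∈ Finset.range (k + 1), (((i : ℝ) + 1) • b (i + 1) + ((k : ℝ) + 1 - i) • b i)
      = ((k : ℝ) + 1) • ∑ j ∈ Finset.range (k + 2), b j := by
    rw [Finset.sum_add_distrib, hsum1, hsum2, ← Finset.sum_add_distrib, Finset.smul_sum]
    refine Finset.sum_congr rfl fun j _ => ?_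
    rw [← add_smul]
    congr 1
    ring
  have hsplit : ∑ i ∈ Finset.range (k + 1),
        (((i : ℝ) + 1) • (φ (x + ((i : ℤ), (k : ℤ) - i))
            - φ (x + ((i : ℤ), (k : ℤ) - i) + (1, 0)))
          + ((k : ℝ) + 1 - i) • (φ (x + ((i : ℤ), (k : ℤ) - i))
            - φ (x + ((i : ℤ), (k : ℤ) - i) + (0, 1))))
      = ((k : ℝ) + 2) • ∑ i ∈ Finset.range (k + 1), φ (x + ((i : ℤ), (k : ℤ) - i))
        - ((k : ℝ) + 1) • ∑ j ∈ Finset.range (k + 2), b j := by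
    rw [← hsum, Finset.smul_sum, ← Finset.sum_sub_distrib]
    refine Finset.sum_congr rfl fun i _ => ?_
    rw [hb1, hb2]
    module
  have hk1 : (k : ℝ) + 1 ≠ 0 := by positivity
  have hk2 : (k : ℝ) + 2 ≠ 0 := by positivity
  rw [hsplit, smul_sub, smul_smul, smul_smul]
  unfold diagAvg
  have hcast : ((k + 1 : ℕ) : ℝ) + 1 = k + 2 := by push_cast; ring
  rw [hcast]
  congr 2
  · field_simp
  · field_simp

lemma norm_diagAvg_sub_sq_le (φ : Conf N) (x : Site) (k : ℕ) :
    ((k : ℝ) + 1) * ‖diagAvg φ x k - diagAvg φ x (k + 1)‖ ^ 2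
      ≤ ∑ i ∈ Finset.range (k + 1), gradSq φ (x + ((i : ℤ), (k : ℤ) - i)) := by
  set g : ℕ → ℝ := fun i => gradSq φ (x + ((i : ℤ), (k : ℤ) - i)) with hg
  have hk1 : (0 : ℝ) < (k : ℝ) + 1 := by positivity
  have hk2 : (0 : ℝ) < (k : ℝ) + 2 := by positivity
  have h1 : ‖diagAvg φ x k - diagAvg φ x (k + 1)‖
      ≤ ((k : ℝ) + 1)⁻¹ * ∑ i ∈ Finset.range (k + 1), √(g i) := by
    rw [diagAvg_sub_diagAvg_succ, norm_smul, Real.norm_of_nonneg (by positivity), mul_inv,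
      mul_assoc]
    gcongr
    rw [inv_mul_le_iff₀ hk2, Finset.mul_sum]
    refine (norm_sum_le _ _).trans (Finset.sum_le_sum fun i hi => ?_)
    have hik : (i : ℝ) ≤ k := by
      exact_mod_cast Nat.lt_succ_iff.1 (Finset.mem_range.1 hi)
    set p : Site := x + ((i : ℤ), (k : ℤ) - i)
    have ha : ‖φ p - φ (p + (1, 0))‖ ≤ √(g i) := by
      apply Real.le_sqrt_of_sq_le
      simp only [hg, gradSq]
      nlinarith [sq_nonneg ‖φ p - φ (p + (0, 1))‖]
    have hb : ‖φ p - φ (p + (0, 1))‖ ≤ √(g i) := by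
      apply Real.le_sqrt_of_sq_le
      simp only [hg, gradSq]
      nlinarith [sq_nonneg ‖φ p - φ (p + (1, 0))‖]
    calc ‖((i : ℝ) + 1) • (φ p - φ (p + (1, 0))) + ((k : ℝ) + 1 - i) • (φ p - φ (p + (0, 1)))‖
        ≤ ((i : ℝ) + 1) * ‖φ p - φ (p + (1, 0))‖ + ((k : ℝ) + 1 - i) * ‖φ p - φ (p + (0, 1))‖ := by
          refine (norm_add_le _ _).trans (le_of_eq ?_)
          rw [norm_smul, norm_smul, Real.norm_of_nonneg (by positivity),
            Real.norm_of_nonneg (by linarith)]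
      _ ≤ ((i : ℝ) + 1) * √(g i) + ((k : ℝ) + 1 - i) * √(g i) := by
          gcongr
          linarith
      _ = ((k : ℝ) + 2) * √(g i) := by ring
  have h2 : (∑ i ∈ Finset.range (k + 1), √(g i)) ^ 2
      ≤ ((k : ℝ) + 1) * ∑ i ∈ Finset.range (k + 1), g i := by
    have := sq_sum_le_card_mul_sum_sq (s := Finset.range (k + 1)) (f := fun i => √(g i))
    simp only [Finset.card_range, Nat.cast_add, Nat.cast_one] at this
    refine this.trans (le_of_eq ?_)
    congr 1
    exact Finset.sum_congr rfl fun i _ => Real.sq_sqrt (gradSq_nonneg _ _)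
  calc ((k : ℝ) + 1) * ‖diagAvg φ x k - diagAvg φ x (k + 1)‖ ^ 2
      ≤ ((k : ℝ) + 1) * (((k : ℝ) + 1)⁻¹ * ∑ i ∈ Finset.range (k + 1), √(g i)) ^ 2 := by gcongr
    _ = ((k : ℝ) + 1)⁻¹ * (∑ i ∈ Finset.range (k + 1), √(g i)) ^ 2 := by field_simp
    _ ≤ ((k : ℝ) + 1)⁻¹ * (((k : ℝ) + 1) * ∑ i ∈ Finset.range (k + 1), g i) := by gcongr
    _ = _ := by rw [inv_mul_cancel_left₀ hk1.ne']

/-- Logarithmic bound of point values by the Dirichlet energy. -/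
lemma VanishesOff.norm_sq_le {n : ℕ} {φ : Conf N} (h : VanishesOff n φ) (x : Site) :
    ‖φ x‖ ^ 2 ≤ 8 * π * (harmonic (2 * n + 1) : ℝ) * dirEnergy n N φ := by
  by_cases hx : x ∈ Lam n
  swap
  · rw [h x hx, norm_zero]
    have h1 := dirEnergy_nonneg n φ
    have h2 : (0 : ℝ) ≤ (harmonic (2 * n + 1) : ℝ) := by
      unfold harmonic; push_cast; positivity
    have h3 := Real.pi_pos
    rw [zero_pow two_ne_zero]
    positivity
  set m := 2 * n + 1 with hm
  have h0 : diagAvg φ x 0 = φ x := by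
    have hz : x + ((0 : ℤ), (0 : ℤ)) = x := add_zero x
    simp [diagAvg, hz]
  have hend : diagAvg φ x m = 0 := by
    unfold diagAvg
    rw [Finset.sum_eq_zero, smul_zero]
    intro i _
    apply h
    rw [mem_Lam_iff] at *
    simp only [Prod.fst_add, Prod.snd_add, hm]
    push_cast
    omega
  have htel : φ x = ∑ k ∈ Finset.range m, (diagAvg φ x k - diagAvg φ x (k + 1)) := by
    rw [Finset.sum_range_sub', h0, hend, sub_zero]
  have hn : ‖φ x‖ ≤ ∑ k ∈ Finset.range m, ‖diagAvg φ x k - diagAvg φ x (k + 1)‖ := by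
    conv_lhs => rw [htel]
    exact norm_sum_le _ _
  have hcs := Finset.sum_sq_le_sum_mul_sum_of_sq_le_mul (Finset.range m)
    (r := fun k => ‖diagAvg φ x k - diagAvg φ x (k + 1)‖)
    (f := fun k : ℕ => ((k : ℝ) + 1)⁻¹)
    (g := fun k : ℕ => ((k : ℝ) + 1) * ‖diagAvg φ x k - diagAvg φ x (k + 1)‖ ^ 2)
    (fun k _ => by positivity) (fun k _ => by positivity)
    (fun k _ => by field_simp; rfl)
  have hharm : ∑ k ∈ Finset.range m, ((k : ℝ) + 1)⁻¹ = (harmonic m : ℝ) := by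
    unfold harmonic; push_cast; rfl
  have hen : ∑ k ∈ Finset.range m, ((k : ℝ) + 1) * ‖diagAvg φ x k - diagAvg φ x (k + 1)‖ ^ 2
      ≤ 8 * π * dirEnergy n N φ := by
    calc _ ≤ ∑ k ∈ Finset.range m, ∑ i ∈ Finset.range (k + 1),
            gradSq φ (x + ((i : ℤ), (k : ℤ) - i)) :=
          Finset.sum_le_sum fun k _ => norm_diagAvg_sub_sq_le φ x k
      _ = ∑ p ∈ (Finset.range m).sigma fun k => Finset.range (k + 1),
            gradSq φ (x + ((p.2 : ℤ), (p.1 : ℤ) - p.2)) := by rw [Finset.sum_sigma]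
      _ ≤ _ := by
          apply h.sum_gradSq_le
          rintro ⟨k, i⟩ _ ⟨k', i'⟩ _ heq
          simp only [add_right_inj, Prod.mk.injEq] at heq
          obtain ⟨h1, h2⟩ := heq
          have e1 : i = i' := by exact_mod_cast h1
          subst e1
          have e2 : k = k' := by omega
          subst e2
          rfl
  have hh0 : (0 : ℝ) ≤ (harmonic m : ℝ) := by rw [← hharm]; positivity
  calc ‖φ x‖ ^ 2 ≤ (∑ k ∈ Finset.range m, ‖diagAvg φ x k - diagAvg φ x (k + 1)‖) ^ 2 := by gcongr
    _ ≤ (harmonic m : ℝ) * (8 * π * dirEnergy n N φ) := by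
        rw [← hharm]
        refine hcs.trans ?_
        gcongr
    _ = _ := by ring

/-- Sums of squared increments over a fixed displacement. -/
lemma VanishesOff.sum_increment_sq_le {n : ℕ} {φ : Conf N} (h : VanishesOff n φ)
    (s : Finset Site) (a b : ℕ) :
    ∑ x ∈ s, ‖φ (x + ((a : ℤ), (b : ℤ))) - φ x‖ ^ 2
      ≤ ((a : ℝ) + b) ^ 2 * (8 * π * dirEnergy n N φ) := by
  set p : ℕ → Site := fun j => (((min j a : ℕ) : ℤ), ((j - a : ℕ) : ℤ)) with hp
  have hstep : ∀ x j, ‖φ (x + p (j + 1)) - φ (x + p j)‖ ^ 2 ≤ gradSq φ (x + p j) := by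
    intro x j
    rw [norm_sub_rev]
    unfold gradSq
    rcases lt_or_ge j a with hj | hj
    · have : x + p (j + 1) = x + p j + (1, 0) := by
        rw [add_assoc]
        congr 1
        ext <;> simp [hp] <;> omega
      rw [this]
      nlinarith [sq_nonneg ‖φ (x + p j) - φ (x + p j + (0, 1))‖]
    · have : x + p (j + 1) = x + p j + (0, 1) := by
        rw [add_assoc]
        congr 1
        ext <;> simp [hp] <;> omega
      rw [this]
      nlinarith [sq_nonneg ‖φ (x + p j) - φ (x + p j + (1, 0))‖]
  have hp0 : p 0 = 0 := by simp [hp]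
  have hpe : p (a + b) = ((a : ℤ), (b : ℤ)) := by ext <;> simp [hp]
  have hpt : ∀ x, ‖φ (x + ((a : ℤ), (b : ℤ))) - φ x‖ ^ 2
      ≤ ((a : ℝ) + b) * ∑ j ∈ Finset.range (a + b), gradSq φ (x + p j) := by
    intro x
    have htel : φ (x + ((a : ℤ), (b : ℤ))) - φ x
        = ∑ j ∈ Finset.range (a + b), (φ (x + p (j + 1)) - φ (x + p j)) := by
      rw [Finset.sum_range_sub (fun j => φ (x + p j)), hp0, hpe, add_zero]
    have h1 := sq_sum_le_card_mul_sum_sq (s := Finset.range (a + b))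
      (f := fun j => ‖φ (x + p (j + 1)) - φ (x + p j)‖)
    simp only [Finset.card_range, Nat.cast_add] at h1
    calc ‖φ (x + ((a : ℤ), (b : ℤ))) - φ x‖ ^ 2
        ≤ (∑ j ∈ Finset.range (a + b), ‖φ (x + p (j + 1)) - φ (x + p j)‖) ^ 2 := by
          rw [htel]
          gcongr
          exact norm_sum_le _ _
      _ ≤ _ := h1
      _ ≤ _ := by
          gcongr with j _
          exact hstep x j
  calc ∑ x ∈ s, ‖φ (x + ((a : ℤ), (b : ℤ))) - φ x‖ ^ 2
      ≤ ∑ x ∈ s, ((a : ℝ) + b) * ∑ j ∈ Finset.range (a + b), gradSq φ (x + p j) :=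
        Finset.sum_le_sum fun x _ => hpt x
    _ = ((a : ℝ) + b) * ∑ j ∈ Finset.range (a + b), ∑ x ∈ s, gradSq φ (x + p j) := by
        rw [← Finset.mul_sum, Finset.sum_comm]
    _ ≤ ((a : ℝ) + b) * ∑ j ∈ Finset.range (a + b), (8 * π * dirEnergy n N φ) := by
        gcongr with j _
        exact h.sum_gradSq_le s (fun x => x + p j) (add_left_injective _).injOn
    _ = _ := by
        rw [Finset.sum_const, Finset.card_range, nsmul_eq_mul]
        push_cast
        ring

end Lattice

section TestFunction

/-- Sup norm of a site. -/
def siteNorm (y : Site) : ℕ := max y.1.natAbs y.2.natAbs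

/-- Squared discrete gradient of a scalar function. -/
def scalarGradSq (f : Site → ℝ) (x : Site) : ℝ :=
  (f x - f (x + ((1 : ℤ), (0 : ℤ)))) ^ 2 + (f x - f (x + ((0 : ℤ), (1 : ℤ)))) ^ 2

lemma scalarGradSq_nonneg (f : Site → ℝ) (x : Site) : 0 ≤ scalarGradSq f x := by
  unfold scalarGradSq; positivity

/-- Logarithmic cutoff at scale `r`. -/
def logCutoff (r : ℕ) (y : Site) : ℝ :=
  max 0 (1 - (harmonic (siteNorm y) : ℝ) / (harmonic r : ℝ))

lemma harmonic_real_succ (k : ℕ) :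
    (harmonic (k + 1) : ℝ) = (harmonic k : ℝ) + ((k : ℝ) + 1)⁻¹ := by
  rw [harmonic_succ]; push_cast; rfl

lemma monotone_harmonic_real : Monotone fun k : ℕ => (harmonic k : ℝ) :=
  monotone_nat_of_le_succ fun k => by
    rw [harmonic_real_succ]
    have : (0 : ℝ) ≤ ((k : ℝ) + 1)⁻¹ := by positivity
    linarith

lemma one_le_harmonic_real {r : ℕ} (hr : 1 ≤ r) : (1 : ℝ) ≤ (harmonic r : ℝ) := by
  have := monotone_harmonic_real hr
  simpa [harmonic] using this

lemma logCutoff_zero (r : ℕ) : logCutoff r 0 = 1 := by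
  simp [logCutoff, siteNorm]

lemma logCutoff_eq_zero {r : ℕ} (hr : 1 ≤ r) {y : Site} (hy : r ≤ siteNorm y) :
    logCutoff r y = 0 := by
  have h1 := one_le_harmonic_real hr
  have h2 := monotone_harmonic_real hy
  rw [logCutoff, max_eq_left]
  have : 1 ≤ (harmonic (siteNorm y) : ℝ) / (harmonic r : ℝ) := by
    rw [le_div_iff₀ (by linarith)]
    simpa using h2
  linarith

lemma abs_harmonic_sub_le {k l : ℕ} (h1 : k ≤ l + 1) (h2 : l ≤ k + 1) :
    |(harmonic k : ℝ) - (harmonic l : ℝ)| ≤ 2 / ((k : ℝ) + 1) := by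
  rcases (show l = k ∨ l = k + 1 ∨ k = l + 1 by omega) with rfl | rfl | rfl
  · simp; positivity
  · rw [harmonic_real_succ, abs_sub_comm, add_sub_cancel_left, abs_of_nonneg (by positivity),
      ← one_div]
    gcongr
    norm_num
  · rw [harmonic_real_succ, add_sub_cancel_left, abs_of_nonneg (by positivity), ← one_div]
    push_cast
    rw [div_le_div_iff₀ (by positivity) (by positivity)]
    have : (0 : ℝ) ≤ l := by positivity
    linarith

lemma logCutoff_sub_sq_le {r : ℕ} (hr : 1 ≤ r) {y y' : Site} (h1 : siteNorm y ≤ siteNorm y' + 1)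
    (h2 : siteNorm y' ≤ siteNorm y + 1) :
    (logCutoff r y - logCutoff r y') ^ 2
      ≤ 4 / (((siteNorm y : ℝ) + 1) ^ 2 * (harmonic r : ℝ) ^ 2) := by
  have hH := one_le_harmonic_real hr
  have h3 : |logCutoff r y - logCutoff r y'| ≤ 2 / ((siteNorm y : ℝ) + 1) / (harmonic r : ℝ) := by
    unfold logCutoff
    rw [max_comm 0, max_comm 0]
    refine (abs_max_sub_max_le_abs _ _ (0 : ℝ)).trans ?_
    rw [sub_sub_sub_cancel_left, ← sub_div, abs_div, abs_sub_comm, abs_of_pos (by linarith : (0:ℝ) < harmonic r)]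
    gcongr
    exact abs_harmonic_sub_le h1 h2
  calc (logCutoff r y - logCutoff r y') ^ 2 = |logCutoff r y - logCutoff r y'| ^ 2 := (sq_abs _).symm
    _ ≤ (2 / ((siteNorm y : ℝ) + 1) / (harmonic r : ℝ)) ^ 2 := by gcongr
    _ = _ := by
      have : (harmonic r : ℝ) ≠ 0 := by linarith
      field_simp
      norm_num

lemma scalarGradSq_logCutoff_le {r : ℕ} (hr : 1 ≤ r) (y : Site) :
    scalarGradSq (logCutoff r) y
      ≤ 8 / (((siteNorm y : ℝ) + 1) ^ 2 * (harmonic r : ℝ) ^ 2) := by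
  have h1 := logCutoff_sub_sq_le hr (y := y) (y' := y + (1, 0))
    (by simp [siteNorm]; omega) (by simp [siteNorm]; omega)
  have h2 := logCutoff_sub_sq_le hr (y := y) (y' := y + (0, 1))
    (by simp [siteNorm]; omega) (by simp [siteNorm]; omega)
  calc _ ≤ _ := add_le_add h1 h2
    _ = _ := by ring

lemma scalarGradSq_logCutoff_eq_zero {r : ℕ} (hr : 1 ≤ r) {y : Site} (hy : r + 1 ≤ siteNorm y) :
    scalarGradSq (logCutoff r) y = 0 := by
  rw [scalarGradSq, logCutoff_eq_zero hr (by omega : r ≤ siteNorm y),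
    logCutoff_eq_zero hr (y := y + (1, 0)) (by simp [siteNorm] at *; omega),
    logCutoff_eq_zero hr (y := y + (0, 1)) (by simp [siteNorm] at *; omega)]
  simp

lemma card_box_le (k : ℕ) : ((Finset.box k : Finset Site).card : ℝ) ≤ 8 * ((k : ℝ) + 1) := by
  rcases Nat.eq_zero_or_pos k with rfl | hk
  · simp
  · rw [Int.card_box hk.ne']
    push_cast
    linarith

lemma sum_scalarGradSq_logCutoff_le {r : ℕ} (hr : 1 ≤ r) (s : Finset Site) :
    ∑ y ∈ s, scalarGradSq (logCutoff r) y ≤ 128 / (harmonic r : ℝ) := by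
  have hH := one_le_harmonic_real hr
  have hd : Set.PairwiseDisjoint (↑(Finset.range (r + 1)))
      (fun k : ℕ => (Finset.box k : Finset Site)) := by
    intro k _ l _ hkl
    rw [Function.onFun, Finset.disjoint_left]
    intro y h1 h2
    rw [Int.mem_box] at h1 h2
    exact hkl (h1.symm.trans h2)
  set u := (Finset.range (r + 1)).biUnion fun k => (Finset.box k : Finset Site)
  have hu : ∀ y, y ∈ u ↔ siteNorm y < r + 1 := by
    intro y
    simp [u, Int.mem_box, siteNorm]
  calc ∑ y ∈ s, scalarGradSq (logCutoff r) y
      ≤ ∑ y ∈ s ∪ u, scalarGradSq (logCutoff r) y :=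
        Finset.sum_le_sum_of_subset_of_nonneg Finset.subset_union_left
          fun _ _ _ => scalarGradSq_nonneg _ _
    _ = ∑ y ∈ u, scalarGradSq (logCutoff r) y :=
        (Finset.sum_subset Finset.subset_union_right fun y _ hy =>
          scalarGradSq_logCutoff_eq_zero hr (by rw [hu] at hy; omega)).symm
    _ = ∑ k ∈ Finset.range (r + 1), ∑ y ∈ (Finset.box k : Finset Site),
          scalarGradSq (logCutoff r) y := Finset.sum_biUnion hd
    _ ≤ ∑ k ∈ Finset.range (r + 1), ∑ y ∈ (Finset.box k : Finset Site),
          8 / (((k : ℝ) + 1) ^ 2 * (harmonic r : ℝ) ^ 2) := by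
        refine Finset.sum_le_sum fun k _ => Finset.sum_le_sum fun y hy => ?_
        have h := scalarGradSq_logCutoff_le hr y
        rw [Int.mem_box] at hy
        rwa [siteNorm, hy] at h
    _ ≤ ∑ k ∈ Finset.range (r + 1), 64 / (harmonic r : ℝ) ^ 2 * ((k : ℝ) + 1)⁻¹ := by
        refine Finset.sum_le_sum fun k _ => ?_
        rw [Finset.sum_const, nsmul_eq_mul]
        calc _ ≤ 8 * ((k : ℝ) + 1) * (8 / (((k : ℝ) + 1) ^ 2 * (harmonic r : ℝ) ^ 2)) := by
              gcongr
              exact card_box_le k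
          _ = _ := by
              have : (harmonic r : ℝ) ≠ 0 := by linarith
              field_simp
              norm_num
    _ = 64 / (harmonic r : ℝ) ^ 2 * (harmonic (r + 1) : ℝ) := by
        rw [← Finset.mul_sum]
        unfold harmonic
        push_cast
        rfl
    _ ≤ 64 / (harmonic r : ℝ) ^ 2 * (2 * (harmonic r : ℝ)) := by
        gcongr
        rw [harmonic_real_succ, two_mul]
        gcongr
        refine le_trans ?_ hH
        exact inv_le_one_of_one_le₀ (by linarith [(Nat.cast_nonneg r : (0 : ℝ) ≤ r)])
    _ = _ := by
        have : (harmonic r : ℝ) ≠ 0 := by linarith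
        field_simp
        norm_num

lemma exists_sum_scalarGradSq_logCutoff_le {η : ℝ} (hη : 0 < η) :
    ∃ r : ℕ, 1 ≤ r ∧ ∀ s : Finset Site, ∑ y ∈ s, scalarGradSq (logCutoff r) y ≤ η := by
  have h1 : Tendsto (fun r : ℕ => Real.log ((r + 1 : ℕ) : ℝ)) atTop atTop :=
    Real.tendsto_log_atTop.comp (tendsto_natCast_atTop_atTop.comp (tendsto_add_atTop_nat 1))
  obtain ⟨r, h2, h3⟩ := ((h1.eventually_ge_atTop (128 / η)).and (eventually_ge_atTop 1)).exists
  refine ⟨r, h3, fun s => (sum_scalarGradSq_logCutoff_le h3 s).trans ?_⟩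
  have h4 := log_add_one_le_harmonic r
  have hH := one_le_harmonic_real h3
  rw [div_le_iff₀ (by linarith), ← div_le_iff₀' hη]
  exact h2.trans h4

end TestFunction

section EnergyForm

variable {n N : ℕ}

lemma extZero_apply_of_mem {x : Site} (v : {x // x ∈ Lam n} → Spin N) (hx : x ∈ Lam n) :
    extZero n v x = v ⟨x, hx⟩ := by
  simp [extZero, hx]

lemma vanishesOff_extZero (v : {x // x ∈ Lam n} → Spin N) : VanishesOff n (extZero n v) :=
  fun x hx => by simp [extZero, hx]

lemma extZero_add (v w : {x // x ∈ Lam n} → Spin N) (x : Site) :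
    extZero n (v + w) x = extZero n v x + extZero n w x := by
  by_cases hx : x ∈ Lam n <;> simp [extZero, hx]

lemma extZero_smul (a : ℝ) (v : {x // x ∈ Lam n} → Spin N) (x : Site) :
    extZero n (a • v) x = a • extZero n v x := by
  by_cases hx : x ∈ Lam n <;> simp [extZero, hx]

lemma extZero_restrict {φ : Conf N} (h : VanishesOff n φ) :
    extZero n (fun x : {x // x ∈ Lam n} => φ x) = φ := by
  funext x
  by_cases hx : x ∈ Lam n
  · simp [extZero, hx]
  · simp [extZero, hx, h x hx]

/-- Inner product of discrete gradients at `x`. -/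
def gradDot (φ ψ : Conf N) (x : Site) : ℝ :=
  inner ℝ (φ x - φ (x + ((1 : ℤ), (0 : ℤ)))) (ψ x - ψ (x + ((1 : ℤ), (0 : ℤ))))
    + inner ℝ (φ x - φ (x + ((0 : ℤ), (1 : ℤ)))) (ψ x - ψ (x + ((0 : ℤ), (1 : ℤ))))

lemma gradDot_comm (φ ψ : Conf N) (x : Site) : gradDot φ ψ x = gradDot ψ φ x := by
  unfold gradDot
  congr 1 <;> exact real_inner_comm _ _

/-- The Dirichlet form on configurations in `Λ_n`. -/
def energyForm (n N : ℕ) : LinearMap.BilinForm ℝ ({x // x ∈ Lam n} → Spin N) :=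
  LinearMap.mk₂ ℝ
    (fun v w => (8 * π)⁻¹ * ∑ x ∈ Lam (n + 4), gradDot (extZero n v) (extZero n w) x)
    (fun v v' w => by
      rw [← mul_add, ← Finset.sum_add_distrib]
      congr 1
      refine Finset.sum_congr rfl fun x _ => ?_
      simp only [gradDot, extZero_add, add_sub_add_comm, inner_add_left]
      ring)
    (fun a v w => by
      rw [smul_eq_mul, mul_left_comm, Finset.mul_sum _ _ a]
      congr 1
      refine Finset.sum_congr rfl fun x _ => ?_
      simp only [gradDot, extZero_smul, ← smul_sub, real_inner_smul_left]
      ring)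
    (fun v w w' => by
      rw [← mul_add, ← Finset.sum_add_distrib]
      congr 1
      refine Finset.sum_congr rfl fun x _ => ?_
      simp only [gradDot, extZero_add, add_sub_add_comm, inner_add_right]
      ring)
    (fun a v w => by
      rw [smul_eq_mul, mul_left_comm, Finset.mul_sum _ _ a]
      congr 1
      refine Finset.sum_congr rfl fun x _ => ?_
      simp only [gradDot, extZero_smul, ← smul_sub, real_inner_smul_right]
      ring)

lemma energyForm_apply (v w : {x // x ∈ Lam n} → Spin N) : energyForm n N v w
    = (8 * π)⁻¹ * ∑ x ∈ Lam (n + 4), gradDot (extZero n v) (extZero n w) x := rfl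

lemma energyForm_self (v : {x // x ∈ Lam n} → Spin N) :
    energyForm n N v v = dirEnergy n N (extZero n v) := by
  simp [energyForm_apply, dirEnergy, gradDot]

lemma harmonic_real_pos {k : ℕ} (hk : 1 ≤ k) : (0 : ℝ) < (harmonic k : ℝ) :=
  lt_of_lt_of_le one_pos (one_le_harmonic_real hk)

/-- Bound on the variance of the field. -/
def varBound (n : ℕ) : ℝ := 8 * π * (harmonic (2 * n + 1) : ℝ)

lemma varBound_pos (n : ℕ) : 0 < varBound n := by
  have := harmonic_real_pos (show 1 ≤ 2 * n + 1 by omega)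
  have := Real.pi_pos
  unfold varBound
  positivity

lemma norm_sq_extZero_le (v : {x // x ∈ Lam n} → Spin N) (x : Site) :
    ‖extZero n v x‖ ^ 2 ≤ varBound n * energyForm n N v v := by
  rw [energyForm_self]
  exact (vanishesOff_extZero v).norm_sq_le x

lemma isCoerciveForm_energyForm (n N : ℕ) : IsCoerciveForm (energyForm n N) := by
  refine ⟨fun v w => ?_, (varBound n)⁻¹, inv_pos.2 (varBound_pos n), fun v => ?_⟩
  · rw [energyForm_apply, energyForm_apply]
    simp only [gradDot_comm (extZero n w) (extZero n v)]
  · rw [inv_mul_le_iff₀ (varBound_pos n)]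
    have h0 : 0 ≤ varBound n * energyForm n N v v :=
      (sq_nonneg _).trans (norm_sq_extZero_le v 0)
    have h1 : ‖v‖ ≤ √(varBound n * energyForm n N v v) := by
      rw [pi_norm_le_iff_of_nonneg (Real.sqrt_nonneg _)]
      intro x
      apply Real.le_sqrt_of_sq_le
      have := norm_sq_extZero_le v x
      rwa [extZero_apply_of_mem v x.2] at this
    calc ‖v‖ ^ 2 ≤ √(varBound n * energyForm n N v v) ^ 2 := by gcongr
      _ = _ := Real.sq_sqrt h0

lemma gffAux_eq (n N : ℕ) : gffAux n N =
    (Measure.pi fun _ => (volume : Measure (Spin N))).withDensity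
      (gaussWeight (energyForm n N)) := by
  unfold gffAux gaussWeight
  simp only [energyForm_self]

/-- The cutoff centred at `c` vanishes outside `Λ_n`. -/
def IsDeep (n r : ℕ) (c : Site) : Prop := ∀ x, siteNorm (x - c) < r → x ∈ Lam n

/-- Energy of the logarithmic cutoff. -/
def cutoffEnergy (r : ℕ) : ℝ := (8 * π)⁻¹ * ∑ᶠ y, scalarGradSq (logCutoff r) y

lemma vanishesOff_logCutoff_smul {r : ℕ} (hr : 1 ≤ r) {c : Site} (hc : IsDeep n r c) (z : Spin N) :
    VanishesOff n fun x => logCutoff r (x - c) • z := by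
  intro x hx
  have : r ≤ siteNorm (x - c) := by
    by_contra h
    exact hx (hc x (by omega))
  simp [logCutoff_eq_zero hr this]

lemma sum_scalarGradSq_translate {r : ℕ} (hr : 1 ≤ r) {c : Site} (hc : IsDeep n r c) :
    ∑ x ∈ Lam (n + 4), scalarGradSq (fun x => logCutoff r (x - c)) x = 8 * π * cutoffEnergy r := by
  have hpi := Real.pi_pos
  have h1 : ∀ x, scalarGradSq (fun x => logCutoff r (x - c)) x
      = scalarGradSq (logCutoff r) (x - c) := by
    intro x
    simp only [scalarGradSq, add_sub_right_comm]
  have h2 : ∑ᶠ x, scalarGradSq (logCutoff r) (x - c) = ∑ᶠ y, scalarGradSq (logCutoff r) y :=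
    finsum_comp_equiv (Equiv.subRight c) (f := scalarGradSq (logCutoff r))
  rw [cutoffEnergy, mul_inv_cancel_left₀ (by positivity), ← h2]
  simp only [← h1]
  symm
  apply finsum_eq_sum_of_support_subset
  intro x hx
  by_contra hx'
  apply hx
  have h3 := (vanishesOff_logCutoff_smul (N := 1) hr hc
    (EuclideanSpace.single 0 1)).gradSq_eq_zero hx'
  simpa [gradSq, ← sub_smul, norm_smul, scalarGradSq] using h3

lemma cutoffEnergy_pos {r : ℕ} (hr : 1 ≤ r) : 0 < cutoffEnergy r := by
  have hpi := Real.pi_pos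
  have hd : IsDeep (2 * r) r 0 := by
    intro x hx
    rw [mem_Lam_iff]
    simp only [siteNorm, sub_zero] at hx
    push_cast
    omega
  have hv := vanishesOff_logCutoff_smul (N := 1) hr hd (EuclideanSpace.single 0 1)
  have h1 := hv.norm_sq_le 0
  have h2 := sum_scalarGradSq_translate hr hd
  have h3 := sum_gradSq_eq (2 * r) (fun x => logCutoff r (x - 0) • EuclideanSpace.single (0 : Fin 1) (1 : ℝ))
  have h4 : ∀ x, gradSq (fun x => logCutoff r (x - 0) • EuclideanSpace.single (0 : Fin 1) (1 : ℝ)) x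
      = scalarGradSq (fun x => logCutoff r (x - 0)) x := by
    intro x
    simp [gradSq, ← sub_smul, norm_smul, scalarGradSq]
  simp only [h4] at h3
  rw [h2] at h3
  have h5 := mul_left_cancel₀ (by positivity) h3
  rw [← h5] at h1
  have h6 := harmonic_real_pos (show 1 ≤ 2 * (2 * r) + 1 by omega)
  by_contra hneg
  have h7 : 8 * π * (harmonic (2 * (2 * r) + 1) : ℝ) * cutoffEnergy r ≤ 0 :=
    mul_nonpos_of_nonneg_of_nonpos (by positivity) (not_lt.1 hneg)
  have h8 : ‖logCutoff r (0 - 0) • EuclideanSpace.single (0 : Fin 1) (1 : ℝ)‖ ^ 2 = 1 := by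
    simp [logCutoff_zero]
  rw [h8] at h1
  linarith

/-- The direction in configuration space of the cutoff centred at `c`. -/
def bump (n N r : ℕ) (c : Site) : Spin N →ₗ[ℝ] ({x // x ∈ Lam n} → Spin N) where
  toFun z := fun x => logCutoff r (x - c) • z
  map_add' z w := by funext x; simp
  map_smul' a z := by funext x; exact smul_comm _ _ _

/-- The coordinate dual to `bump`. -/
def bumpCoord (n N r : ℕ) (c : Site) : ({x // x ∈ Lam n} → Spin N) →ₗ[ℝ] Spin N where
  toFun v := (8 * π * cutoffEnergy r)⁻¹ • ∑ x ∈ Lam (n + 4),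
    ((logCutoff r (x - c) - logCutoff r (x + (1, 0) - c))
        • (extZero n v x - extZero n v (x + (1, 0)))
      + (logCutoff r (x - c) - logCutoff r (x + (0, 1) - c))
        • (extZero n v x - extZero n v (x + (0, 1))))
  map_add' v w := by
    rw [← smul_add, ← Finset.sum_add_distrib]
    congr 1
    refine Finset.sum_congr rfl fun x _ => ?_
    simp only [extZero_add]
    module
  map_smul' a v := by
    rw [RingHom.id_apply, smul_comm a, Finset.smul_sum (r := a)]
    congr 1
    refine Finset.sum_congr rfl fun x _ => ?_
    simp only [extZero_smul]
    module

lemma extZero_bump {r : ℕ} (hr : 1 ≤ r) {c : Site} (hc : IsDeep n r c) (z : Spin N) :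
    extZero n (bump n N r c z) = fun x => logCutoff r (x - c) • z :=
  extZero_restrict (vanishesOff_logCutoff_smul hr hc z)

lemma extZero_bump_apply {r : ℕ} (hr : 1 ≤ r) {c : Site} (hc : IsDeep n r c) (z : Spin N)
    (x : Site) : extZero n (bump n N r c z) x = logCutoff r (x - c) • z :=
  congrFun (extZero_bump hr hc z) x

lemma isGaussCoord_bump {r : ℕ} (hr : 1 ≤ r) {c : Site} (hc : IsDeep n r c) :
    IsGaussCoord (energyForm n N) (cutoffEnergy r) (bump n N r c) (bumpCoord n N r c) := by
  have hpi := Real.pi_pos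
  have he := cutoffEnergy_pos hr
  constructor
  · intro v z
    rw [energyForm_apply, extZero_bump hr hc]
    simp only [bumpCoord, LinearMap.coe_mk, AddHom.coe_mk, real_inner_smul_left, sum_inner,
      inner_add_left, gradDot, ← sub_smul, real_inner_smul_right]
    field_simp
  · intro z
    simp only [bumpCoord, LinearMap.coe_mk, AddHom.coe_mk, extZero_bump hr hc, ← sub_smul,
      smul_smul, ← add_smul, ← Finset.sum_smul]
    have := sum_scalarGradSq_translate hr hc
    simp only [scalarGradSq, sq] at this
    rw [this, inv_mul_cancel₀ (by positivity), one_smul]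

lemma exists_cutoffEnergy_le {η : ℝ} (hη : 0 < η) : ∃ r : ℕ, 1 ≤ r ∧ cutoffEnergy r ≤ η := by
  have hpi := Real.pi_pos
  obtain ⟨r, hr, h⟩ := exists_sum_scalarGradSq_logCutoff_le (show 0 < 8 * π * η by positivity)
  refine ⟨r, hr, ?_⟩
  have hd : IsDeep (2 * r) r 0 := by
    intro x hx
    rw [mem_Lam_iff]
    simp only [siteNorm, sub_zero] at hx
    push_cast
    omega
  have h1 := sum_scalarGradSq_translate hr hd
  simp only [sub_zero] at h1
  have h2 := h (Lam (2 * r + 4))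
  rw [h1] at h2
  exact le_of_mul_le_mul_left h2 (by positivity)

end EnergyForm

section BallResample

variable {E : Type*} [NormedAddCommGroup E] [InnerProductSpace ℝ E] [FiniteDimensional ℝ E]
  [MeasurableSpace E] [BorelSpace E]

/-- Indicator of the complement of the ball of radius `R`, tilted by `exp p` on the
ball of radius `S`. -/
def tiltedAvoid (R S p : ℝ) (w : E) : ℝ≥0∞ :=
  if ‖w‖ < R then 0 else ENNReal.ofReal (Real.exp (if ‖w‖ ≤ S then p else 0))

lemma measurable_tiltedAvoid {F : Type*} [NormedAddCommGroup F] [MeasurableSpace F]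
    [BorelSpace F] (R S p : ℝ) : Measurable (tiltedAvoid (E := F) R S p) := by
  unfold tiltedAvoid
  refine Measurable.ite (measurableSet_lt measurable_norm measurable_const) measurable_const ?_
  refine (Real.measurable_exp.comp ?_).ennreal_ofReal
  exact Measurable.ite (measurableSet_le measurable_norm measurable_const) measurable_const
    measurable_const

/-- Lower bound for the relative Gaussian mass of a ball of radius `R` with centre of norm at
most `2 S`. -/
def ballMass (E : Type*) [NormedAddCommGroup E] [InnerProductSpace ℝ E] [FiniteDimensional ℝ E]
    [MeasurableSpace E] [BorelSpace E] (e R S : ℝ) : ℝ :=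
  (volume (Metric.ball (0 : E) R)).toReal / (∫⁻ z : E, radialWeight e z).toReal
    * Real.exp (-(e * (2 * S + R) ^ 2))

lemma lintegral_radialWeight_toReal_pos {e : ℝ} (he : 0 < e) :
    0 < (∫⁻ z : E, radialWeight e z).toReal :=
  ENNReal.toReal_pos (lintegral_radialWeight_ne_zero e) (lintegral_radialWeight_ne_top he)

lemma ballMass_mul_le {e R S : ℝ} (he : 0 < e) {Y : E}
    (hY : ‖Y‖ ≤ 2 * S) : ENNReal.ofReal (ballMass E e R S) * ∫⁻ z : E, radialWeight e z
      ≤ ∫⁻ z in {z : E | ‖Y + z‖ < R}, radialWeight e z := by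
  have hC := lintegral_radialWeight_toReal_pos (E := E) he
  have hset : {z : E | ‖Y + z‖ < R} = Metric.ball (-Y) R := by
    ext z
    simp [dist_eq_norm, add_comm]
  have hvol : volume (Metric.ball (-Y) R) = volume (Metric.ball (0 : E) R) :=
    Measure.addHaar_ball_center volume _ _
  calc ENNReal.ofReal (ballMass E e R S) * ∫⁻ z : E, radialWeight e z
      = ENNReal.ofReal (Real.exp (-(e * (2 * S + R) ^ 2))) * volume (Metric.ball (-Y) R) := by
        conv_lhs => rw [← ENNReal.ofReal_toReal (lintegral_radialWeight_ne_top (E := E) he)]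
        rw [hvol, ← ENNReal.ofReal_toReal (measure_ball_lt_top (μ := volume) (x := (0 : E))).ne,
          ← ENNReal.ofReal_mul (by unfold ballMass; positivity),
          ← ENNReal.ofReal_mul (by positivity)]
        congr 1
        unfold ballMass
        field_simp
    _ = ∫⁻ z in {z : E | ‖Y + z‖ < R}, ENNReal.ofReal (Real.exp (-(e * (2 * S + R) ^ 2))) := by
        rw [setLIntegral_const, hset]
    _ ≤ _ := by
        refine setLIntegral_mono (measurable_radialWeight e) fun z hz => ?_
        unfold radialWeight
        gcongr
        have h1 : ‖z‖ ≤ ‖Y + z‖ + ‖Y‖ := by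
          calc ‖z‖ = ‖(Y + z) - Y‖ := by rw [add_sub_cancel_left]
            _ ≤ _ := norm_sub_le _ _
        have h2 : ‖Y + z‖ < R := hz
        linarith

lemma ballMass_pos {e R S : ℝ} (he : 0 < e) (hR : 0 < R) : 0 < ballMass E e R S := by
  have hC := lintegral_radialWeight_toReal_pos (E := E) he
  have hV : 0 < (volume (Metric.ball (0 : E) R)).toReal :=
    ENNReal.toReal_pos (Metric.measure_ball_pos volume _ hR).ne' measure_ball_lt_top.ne
  unfold ballMass
  positivity

lemma ballMass_le_one {e R S : ℝ} (he : 0 < e) (hS : 0 ≤ S) :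
    ballMass E e R S ≤ 1 := by
  have h1 := (ballMass_mul_le (E := E) he (R := R) (Y := 0) (by simpa using hS)).trans
    (setLIntegral_le_lintegral _ _)
  have h2 : ENNReal.ofReal (ballMass E e R S) ≤ 1 := by
    by_contra h
    refine absurd h1 (not_le.2 ?_)
    conv_lhs => rw [← one_mul (∫⁻ z : E, radialWeight e z)]
    exact ENNReal.mul_lt_mul_left (lintegral_radialWeight_ne_zero e)
      (lintegral_radialWeight_ne_top he) (not_le.1 h)
  rwa [← ENNReal.ofReal_one, ENNReal.ofReal_le_ofReal_iff zero_le_one] at h2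

lemma exists_tail_radialWeight_le {e τ : ℝ} (he : 0 < e) (hτ : 0 < τ) :
    ∀ᶠ S : ℝ in atTop, ∫⁻ z in {z : E | S ≤ ‖z‖}, radialWeight e z
      ≤ ENNReal.ofReal τ * ∫⁻ z : E, radialWeight e z := by
  have he2 : 0 < e / 2 := by positivity
  set C := ∫⁻ z : E, radialWeight e z
  set C' := ∫⁻ z : E, radialWeight (e / 2) z
  have hC : 0 < C.toReal := lintegral_radialWeight_toReal_pos he
  have hC' : 0 < C'.toReal := lintegral_radialWeight_toReal_pos he2
  have hlim : Tendsto (fun S : ℝ => Real.exp (-(e / 2 * S ^ 2))) atTop (nhds 0) :=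
    Real.tendsto_exp_neg_atTop_nhds_zero.comp
      ((tendsto_pow_atTop two_ne_zero).const_mul_atTop he2)
  have h1 : 0 < τ * C.toReal / C'.toReal := by positivity
  filter_upwards [hlim.eventually_lt_const h1, eventually_ge_atTop 0] with S hS hS0
  calc ∫⁻ z in {z : E | S ≤ ‖z‖}, radialWeight e z
      ≤ ∫⁻ z in {z : E | S ≤ ‖z‖},
          ENNReal.ofReal (Real.exp (-(e / 2 * S ^ 2))) * radialWeight (e / 2) z := by
        refine setLIntegral_mono ((measurable_radialWeight _).const_mul _) fun z hz => ?_
        unfold radialWeight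
        rw [← ENNReal.ofReal_mul (Real.exp_pos _).le, ← Real.exp_add]
        gcongr
        have : S ^ 2 ≤ ‖z‖ ^ 2 := by
          have : S ≤ ‖z‖ := hz
          gcongr
        nlinarith
    _ ≤ ∫⁻ z : E, ENNReal.ofReal (Real.exp (-(e / 2 * S ^ 2))) * radialWeight (e / 2) z :=
        setLIntegral_le_lintegral _ _
    _ = ENNReal.ofReal (Real.exp (-(e / 2 * S ^ 2))) * C' :=
        lintegral_const_mul _ (measurable_radialWeight _)
    _ ≤ ENNReal.ofReal τ * C := by
        rw [← ENNReal.ofReal_toReal (show C' ≠ ∞ from lintegral_radialWeight_ne_top he2),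
          ← ENNReal.ofReal_toReal (show C ≠ ∞ from lintegral_radialWeight_ne_top he),
          ← ENNReal.ofReal_mul (by positivity), ← ENNReal.ofReal_mul (by positivity)]
        refine ENNReal.ofReal_le_ofReal ?_
        rw [lt_div_iff₀ hC'] at hS
        exact hS.le

lemma lintegral_tiltedAvoid_le_of_near {e R S τ : ℝ} (he : 0 < e) (hR : 0 < R) (hτ : 0 < τ)
    {Y : E} (hY : ‖Y‖ ≤ 2 * S) :
    ∫⁻ z, radialWeight e z * tiltedAvoid R S (ballMass E e R S) (Y + z)
      ≤ ENNReal.ofReal (Real.exp (2 * ballMass E e R S * τ)) * ∫⁻ z : E, radialWeight e z := by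
  set p := ballMass E e R S with hp
  have hp0 : 0 < p := ballMass_pos he hR
  set b : Set E := {z : E | ‖Y + z‖ < R} with hb
  have hbm : MeasurableSet b :=
    measurableSet_lt (measurable_const.add measurable_id).norm measurable_const
  set C := ∫⁻ z : E, radialWeight e z with hCdef
  have hCtop : C ≠ ∞ := lintegral_radialWeight_ne_top he
  have h1 : ENNReal.ofReal p * C ≤ ∫⁻ z in b, radialWeight e z := ballMass_mul_le he hY
  have h2 : (∫⁻ z in b, radialWeight e z) + ∫⁻ z in bᶜ, radialWeight e z = C :=
    lintegral_add_compl _ hbm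
  set X := ∫⁻ z in bᶜ, radialWeight e z with hX
  have hXtop : X ≠ ∞ := ne_top_of_le_ne_top hCtop (setLIntegral_le_lintegral _ _)
  have h3 : ENNReal.ofReal p * C + X ≤ C := by
    conv_rhs => rw [← h2]
    gcongr
  have h4 : p * C.toReal + X.toReal ≤ C.toReal := by
    have := ENNReal.toReal_mono hCtop h3
    rwa [ENNReal.toReal_add (ENNReal.mul_ne_top ENNReal.ofReal_ne_top hCtop) hXtop,
      ENNReal.toReal_mul, ENNReal.toReal_ofReal hp0.le] at this
  calc ∫⁻ z, radialWeight e z * tiltedAvoid R S p (Y + z)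
      ≤ ∫⁻ z, bᶜ.indicator (fun z => ENNReal.ofReal (Real.exp p) * radialWeight e z) z := by
        refine lintegral_mono fun z => ?_
        by_cases hz : ‖Y + z‖ < R
        · simp [tiltedAvoid, hz]
        · rw [Set.indicator_of_mem (show z ∈ bᶜ from hz), tiltedAvoid, if_neg hz, mul_comm]
          gcongr
          split_ifs <;> linarith
    _ = ENNReal.ofReal (Real.exp p) * X := by
        rw [lintegral_indicator hbm.compl, lintegral_const_mul _ (measurable_radialWeight e)]
    _ ≤ C := by
        rw [← ENNReal.ofReal_toReal hXtop, ← ENNReal.ofReal_toReal hCtop,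
          ← ENNReal.ofReal_mul (Real.exp_pos _).le]
        refine ENNReal.ofReal_le_ofReal ?_
        have h5 : 1 - p ≤ Real.exp (-p) := Real.one_sub_le_exp_neg p
        calc Real.exp p * X.toReal ≤ Real.exp p * ((1 - p) * C.toReal) := by
              gcongr
              linarith
          _ ≤ Real.exp p * (Real.exp (-p) * C.toReal) := by gcongr
          _ = C.toReal := by rw [← mul_assoc, ← Real.exp_add, add_neg_cancel, Real.exp_zero, one_mul]
    _ ≤ ENNReal.ofReal (Real.exp (2 * p * τ)) * C := by
        conv_lhs => rw [← one_mul C]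
        gcongr
        rw [← ENNReal.ofReal_one]
        exact ENNReal.ofReal_le_ofReal (Real.one_le_exp (by positivity))

lemma lintegral_tiltedAvoid_le_of_far {e R S τ : ℝ} (he : 0 < e) (hR : 0 < R) (hS : 0 ≤ S)
    (hτ : 0 < τ) (htail : ∫⁻ z in {z : E | S ≤ ‖z‖}, radialWeight e z
      ≤ ENNReal.ofReal τ * ∫⁻ z : E, radialWeight e z) {Y : E} (hY : 2 * S < ‖Y‖) :
    ∫⁻ z, radialWeight e z * tiltedAvoid R S (ballMass E e R S) (Y + z)
      ≤ ENNReal.ofReal (Real.exp (2 * ballMass E e R S * τ)) * ∫⁻ z : E, radialWeight e z := by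
  set p := ballMass E e R S with hp
  have hp0 : 0 < p := ballMass_pos he hR
  have hp1 : p ≤ 1 := ballMass_le_one he hS
  set C := ∫⁻ z : E, radialWeight e z with hCdef
  set t : Set E := {z : E | S ≤ ‖z‖} with ht
  have htm : MeasurableSet t := measurableSet_le measurable_const measurable_norm
  have hexp : Real.exp p ≤ 1 + 2 * p := by
    have := (abs_le.1 (Real.abs_exp_sub_one_sub_id_le (x := p) (by rwa [abs_of_pos hp0]))).2
    nlinarith
  calc ∫⁻ z, radialWeight e z * tiltedAvoid R S p (Y + z)
      ≤ ∫⁻ z, (radialWeight e z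
          + t.indicator (fun z => ENNReal.ofReal (2 * p) * radialWeight e z) z) := by
        refine lintegral_mono fun z => ?_
        unfold tiltedAvoid
        split_ifs with h1 h2
        · simp
        · have hz : z ∈ t := by
            have h3 : ‖Y‖ ≤ ‖Y + z‖ + ‖z‖ := by
              calc ‖Y‖ = ‖(Y + z) - z‖ := by rw [add_sub_cancel_right]
                _ ≤ _ := norm_sub_le _ _
            show S ≤ ‖z‖
            linarith
          rw [Set.indicator_of_mem hz]
          calc radialWeight e z * ENNReal.ofReal (Real.exp p)
              ≤ radialWeight e z * ENNReal.ofReal (1 + 2 * p) := by gcongr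
            _ = _ := by
              rw [ENNReal.ofReal_add zero_le_one (by positivity), ENNReal.ofReal_one]
              ring
        · simp
    _ = C + ENNReal.ofReal (2 * p) * ∫⁻ z in t, radialWeight e z := by
        rw [lintegral_add_left (measurable_radialWeight e), lintegral_indicator htm,
          lintegral_const_mul _ (measurable_radialWeight e)]
    _ ≤ C + ENNReal.ofReal (2 * p) * (ENNReal.ofReal τ * C) := by gcongr
    _ = ENNReal.ofReal (1 + 2 * p * τ) * C := by
        rw [ENNReal.ofReal_add zero_le_one (by positivity), ENNReal.ofReal_one,
          ENNReal.ofReal_mul (show 0 ≤ 2 * p by positivity)]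
        ring
    _ ≤ _ := by
        gcongr
        have := Real.add_one_le_exp (2 * p * τ)
        linarith

end BallResample

section SmallValues

variable {n N : ℕ}

/-- Configurations in `Λ_n` of norm at least `R` on `X`. -/
def safeSet (n N : ℕ) (X : Finset Site) (R : ℝ) : Set ({x // x ∈ Lam n} → Spin N) :=
  {v | ∀ x ∈ X, R ≤ ‖extZero n v x‖}

lemma measurable_extZero_apply (x : Site) :
    Measurable fun v : {x // x ∈ Lam n} → Spin N => extZero n v x := by
  unfold extZero
  split_ifs with h
  · exact measurable_pi_apply _
  · exact measurable_const

lemma measurableSet_safeSet (X : Finset Site) (R : ℝ) : MeasurableSet (safeSet n N X R) := by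
  have : safeSet n N X R = ⋂ x ∈ X, {v | R ≤ ‖extZero n v x‖} := by
    ext v; simp [safeSet]
  rw [this]
  exact X.measurableSet_biInter fun x _ =>
    measurableSet_le measurable_const (measurable_extZero_apply x).norm

lemma gffAux_univ : gffAux n N Set.univ = ∫⁻ v, gaussWeight (energyForm n N) v
    ∂(Measure.pi fun _ => (volume : Measure (Spin N))) := by
  rw [gffAux_eq, withDensity_apply _ MeasurableSet.univ, Measure.restrict_univ]

instance isFiniteMeasure_gffAux : IsFiniteMeasure (gffAux n N) :=
  ⟨by
    rw [gffAux_univ]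
    exact lintegral_gaussWeight_lt_top _ (isCoerciveForm_energyForm n N)⟩

lemma gffAux_univ_ne_zero : gffAux n N Set.univ ≠ 0 := by
  rw [gffAux_univ]
  exact lintegral_gaussWeight_ne_zero _ _

lemma lintegral_gffAux {F : ({x // x ∈ Lam n} → Spin N) → ℝ≥0∞} (hF : Measurable F) :
    ∫⁻ v, F v ∂(gffAux n N) = ∫⁻ v, gaussWeight (energyForm n N) v * F v
      ∂(Measure.pi fun _ => (volume : Measure (Spin N))) := by
  rw [gffAux_eq, lintegral_withDensity_eq_lintegral_mul _ (measurable_gaussWeight _) hF]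
  rfl

lemma measurableSet_norm_extZero_le (x : Site) (S : ℝ) :
    MeasurableSet {v : {x // x ∈ Lam n} → Spin N | ‖extZero n v x‖ ≤ S} :=
  measurableSet_le (measurable_extZero_apply x).norm measurable_const

lemma lintegral_prod_tiltedAvoid_le {r : ℕ} (hr : 1 ≤ r) {R S τ : ℝ} (hR : 0 < R) (hS : 0 ≤ S)
    (hτ : 0 < τ) (htail : ∫⁻ z in {z : Spin N | S ≤ ‖z‖}, radialWeight (cutoffEnergy r) z
      ≤ ENNReal.ofReal τ * ∫⁻ z : Spin N, radialWeight (cutoffEnergy r) z) (s : Finset Site)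
    (hdeep : ∀ c ∈ s, IsDeep n r c)
    (hsep : ∀ c ∈ s, ∀ c' ∈ s, c ≠ c' → r ≤ siteNorm (c - c')) :
    ∫⁻ v, ∏ c ∈ s, tiltedAvoid R S (ballMass (Spin N) (cutoffEnergy r) R S) (extZero n v c)
        ∂(gffAux n N)
      ≤ ENNReal.ofReal (Real.exp (2 * ballMass (Spin N) (cutoffEnergy r) R S * τ)) ^ s.card
        * gffAux n N Set.univ := by
  have he := cutoffEnergy_pos hr
  have hU : ∀ c, Measurable fun v : {x // x ∈ Lam n} → Spin N =>
      tiltedAvoid R S (ballMass (Spin N) (cutoffEnergy r) R S) (extZero n v c) :=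
    fun c => (measurable_tiltedAvoid _ _ _).comp (measurable_extZero_apply c)
  rw [lintegral_gffAux (Finset.measurable_prod _ fun c _ => hU c), gffAux_univ]
  refine lintegral_prod_resample_le _ (isCoerciveForm_energyForm n N) he s
    (k := bump n N r) (Z := bumpCoord n N r) (fun c hc => isGaussCoord_bump hr (hdeep c hc))
    hU ?_ ?_
  · intro i hi j hj hij v z
    rw [extZero_add, extZero_bump_apply hr (hdeep j hj), logCutoff_eq_zero hr (hsep i hi j hj hij),
      zero_smul, add_zero]
  · intro c hc v
    have h1 : ∀ z, extZero n (v - bump n N r c (bumpCoord n N r c v) + bump n N r c z) c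
        = (extZero n v c - bumpCoord n N r c v) + z := by
      intro z
      rw [extZero_add, sub_eq_add_neg, extZero_add, ← map_neg, extZero_bump_apply hr (hdeep c hc),
        extZero_bump_apply hr (hdeep c hc), sub_self, logCutoff_zero, one_smul, one_smul,
        sub_eq_add_neg]
    simp only [h1]
    rcases le_or_gt ‖extZero n v c - bumpCoord n N r c v‖ (2 * S) with hY | hY
    · exact lintegral_tiltedAvoid_le_of_near he hR hτ hY
    · exact lintegral_tiltedAvoid_le_of_far he hR hS hτ htail hY

lemma sum_measure_small_le_of_separated {r : ℕ} (hr : 1 ≤ r) {R S τ H : ℝ} (hR : 0 < R)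
    (hS : 0 ≤ S) (hτ : 0 < τ) (hH0 : 0 ≤ H)
    (htail : ∫⁻ z in {z : Spin N | S ≤ ‖z‖}, radialWeight (cutoffEnergy r) z
      ≤ ENNReal.ofReal τ * ∫⁻ z : Spin N, radialWeight (cutoffEnergy r) z) {X : Finset Site}
    (hH : gffAux n N Set.univ ≤ ENNReal.ofReal (Real.exp H) * gffAux n N (safeSet n N X R))
    (s : Finset Site) (hsX : s ⊆ X) (hdeep : ∀ c ∈ s, IsDeep n r c)
    (hsep : ∀ c ∈ s, ∀ c' ∈ s, c ≠ c' → r ≤ siteNorm (c - c')) :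
    ∑ c ∈ s, gffAux n N (safeSet n N X R ∩ {v | ‖extZero n v c‖ ≤ S})
      ≤ ENNReal.ofReal (2 * τ * s.card + H / ballMass (Spin N) (cutoffEnergy r) R S)
        * gffAux n N (safeSet n N X R) := by
  have he := cutoffEnergy_pos hr
  set p := ballMass (Spin N) (cutoffEnergy r) R S with hp
  have hp0 : 0 < p := ballMass_pos he hR
  set ρ := gffAux n N with hρ
  set O := safeSet n N X R with hO
  have hOm : MeasurableSet O := measurableSet_safeSet X R
  set F : ({x // x ∈ Lam n} → Spin N) → ℝ :=
    fun v => ∑ c ∈ s, if ‖extZero n v c‖ ≤ S then p else 0 with hF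
  have hFm : Measurable F := Finset.measurable_sum _ fun c _ =>
    Measurable.ite (measurableSet_norm_extZero_le c S) measurable_const measurable_const
  have hF0 : ∀ v, 0 ≤ F v := fun v => Finset.sum_nonneg fun c _ => by split_ifs <;> linarith
  have h1 : ∫⁻ v in O, ENNReal.ofReal (Real.exp (F v)) ∂ρ
      ≤ ENNReal.ofReal (Real.exp (2 * p * τ * s.card + H)) * ρ O := by
    calc ∫⁻ v in O, ENNReal.ofReal (Real.exp (F v)) ∂ρ
        ≤ ∫⁻ v in O, ∏ c ∈ s, tiltedAvoid R S p (extZero n v c) ∂ρ := by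
          refine setLIntegral_mono' hOm fun v hv => le_of_eq ?_
          rw [hF, Real.exp_sum, ENNReal.ofReal_prod_of_nonneg fun _ _ => (Real.exp_pos _).le]
          refine Finset.prod_congr rfl fun c hc => ?_
          rw [tiltedAvoid, if_neg (not_lt.2 (hv c (hsX hc)))]
      _ ≤ ∫⁻ v, ∏ c ∈ s, tiltedAvoid R S p (extZero n v c) ∂ρ := setLIntegral_le_lintegral _ _
      _ ≤ ENNReal.ofReal (Real.exp (2 * p * τ)) ^ s.card * ρ Set.univ :=
          lintegral_prod_tiltedAvoid_le hr hR hS hτ htail s hdeep hsep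
      _ ≤ ENNReal.ofReal (Real.exp (2 * p * τ)) ^ s.card
            * (ENNReal.ofReal (Real.exp H) * ρ O) := by gcongr
      _ = _ := by
          rw [← mul_assoc, ← ENNReal.ofReal_pow (Real.exp_pos _).le,
            ← ENNReal.ofReal_mul (by positivity), ← Real.exp_nat_mul, ← Real.exp_add]
          congr 4
          ring
  have h2 := setLIntegral_le_of_exp hFm hF0 (by positivity) h1
  have h3 : ∫⁻ v in O, ENNReal.ofReal (F v) ∂ρ
      = ENNReal.ofReal p * ∑ c ∈ s, ρ (O ∩ {v | ‖extZero n v c‖ ≤ S}) := by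
    have h4 : ∀ v, ENNReal.ofReal (F v) = ∑ c ∈ s,
        {v | ‖extZero n v c‖ ≤ S}.indicator (fun _ => ENNReal.ofReal p) v := by
      intro v
      rw [hF, ENNReal.ofReal_sum_of_nonneg fun c _ => by split_ifs <;> linarith]
      refine Finset.sum_congr rfl fun c _ => ?_
      by_cases h : ‖extZero n v c‖ ≤ S <;> simp [h]
    simp_rw [h4]
    rw [lintegral_finsetSum _ fun c _ => measurable_const.indicator
      (measurableSet_norm_extZero_le c S), Finset.mul_sum]
    refine Finset.sum_congr rfl fun c _ => ?_
    rw [lintegral_indicator (measurableSet_norm_extZero_le c S), setLIntegral_const,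
      Measure.restrict_apply (measurableSet_norm_extZero_le c S), Set.inter_comm]
  rw [h3] at h2
  have hpne : ENNReal.ofReal p ≠ 0 := by simpa using hp0
  refine (ENNReal.mul_le_mul_iff_right hpne ENNReal.ofReal_ne_top).1 (h2.trans (le_of_eq ?_))
  rw [← mul_assoc, ← ENNReal.ofReal_mul hp0.le]
  congr 2
  field_simp

lemma sum_measure_small_le {r : ℕ} (hr : 1 ≤ r) {R S τ H : ℝ} (hR : 0 < R)
    (hS : 0 ≤ S) (hτ : 0 < τ) (hH0 : 0 ≤ H)
    (htail : ∫⁻ z in {z : Spin N | S ≤ ‖z‖}, radialWeight (cutoffEnergy r) z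
      ≤ ENNReal.ofReal τ * ∫⁻ z : Spin N, radialWeight (cutoffEnergy r) z) {X : Finset Site}
    (hH : gffAux n N Set.univ ≤ ENNReal.ofReal (Real.exp H) * gffAux n N (safeSet n N X R))
    (hdeep : ∀ c ∈ X, IsDeep n r c) :
    ∑ c ∈ X, gffAux n N (safeSet n N X R ∩ {v | ‖extZero n v c‖ ≤ S})
      ≤ ENNReal.ofReal (2 * τ * X.card + r ^ 2 * (H / ballMass (Spin N) (cutoffEnergy r) R S))
        * gffAux n N (safeSet n N X R) := by
  have he := cutoffEnergy_pos hr
  set p := ballMass (Spin N) (cutoffEnergy r) R S with hp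
  have hp0 : 0 < p := ballMass_pos he hR
  have hr0 : (r : ℤ) ≠ 0 := by omega
  set I : Finset Site := Finset.Ico 0 (r : ℤ) ×ˢ Finset.Ico 0 (r : ℤ) with hI
  set g : Site → Site := fun c => (c.1 % r, c.2 % r) with hg
  have hmaps : ∀ c ∈ X, g c ∈ I := by
    intro c _
    simp only [hI, hg, Finset.mem_product, Finset.mem_Ico]
    exact ⟨⟨Int.emod_nonneg _ hr0, Int.emod_lt_of_pos _ (by omega)⟩,
      Int.emod_nonneg _ hr0, Int.emod_lt_of_pos _ (by omega)⟩
  have hsep : ∀ i, ∀ c ∈ X.filter (g · = i), ∀ c' ∈ X.filter (g · = i), c ≠ c' →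
      r ≤ siteNorm (c - c') := by
    intro i c hc c' hc' hne
    have h1 : g c = g c' := (Finset.mem_filter.1 hc).2.trans (Finset.mem_filter.1 hc').2.symm
    simp only [hg, Prod.mk.injEq] at h1
    have h2 : (r : ℤ) ∣ c.1 - c'.1 := Int.ModEq.dvd (Int.ModEq.symm h1.1)
    have h3 : (r : ℤ) ∣ c.2 - c'.2 := Int.ModEq.dvd (Int.ModEq.symm h1.2)
    by_contra hlt
    simp only [siteNorm, Prod.fst_sub, Prod.snd_sub, not_le, max_lt_iff] at hlt
    have h4 := Int.eq_zero_of_abs_lt_dvd h2 (by rw [Int.abs_eq_natAbs]; omega)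
    have h5 := Int.eq_zero_of_abs_lt_dvd h3 (by rw [Int.abs_eq_natAbs]; omega)
    exact hne (Prod.ext (by omega) (by omega))
  rw [← Finset.sum_fiberwise_of_maps_to hmaps]
  calc _ ≤ ∑ i ∈ I, ENNReal.ofReal (2 * τ * (X.filter (g · = i)).card + H / p)
          * gffAux n N (safeSet n N X R) :=
        Finset.sum_le_sum fun i _ => sum_measure_small_le_of_separated hr hR hS hτ hH0 htail hH _
          (Finset.filter_subset _ _) (fun c hc => hdeep c (Finset.mem_filter.1 hc).1) (hsep i)
    _ = _ := by
        rw [← Finset.sum_mul, ← ENNReal.ofReal_sum_of_nonneg fun i _ => by positivity,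
          Finset.sum_add_distrib, ← Finset.mul_sum, ← Nat.cast_sum,
          ← Finset.card_eq_sum_card_fiberwise hmaps, Finset.sum_const, hI, Finset.card_product,
          Int.card_Ico, nsmul_eq_mul]
        congr 3
        rw [sub_zero, Int.toNat_natCast]
        push_cast
        ring

end SmallValues

section Estimates

variable {n N : ℕ}

/-- Evaluation of one component of the field at `x`. -/
def coordEval (n : ℕ) {N : ℕ} (x : Site) (i : Fin N) :
    ({x // x ∈ Lam n} → Spin N) →ₗ[ℝ] ℝ where
  toFun v := extZero n v x i
  map_add' v w := by rw [extZero_add]; rfl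
  map_smul' a v := by rw [extZero_smul]; rfl

lemma coordEval_apply (x : Site) (i : Fin N) (v : {x // x ∈ Lam n} → Spin N) :
    coordEval n x i v = extZero n v x i := rfl

lemma sq_apply_le_norm_sq (w : Spin N) (i : Fin N) : w i ^ 2 ≤ ‖w‖ ^ 2 := by
  rw [EuclideanSpace.real_norm_sq_eq]
  exact Finset.single_le_sum (f := fun i => w i ^ 2) (fun j _ => sq_nonneg _) (Finset.mem_univ i)

lemma coordEval_sq_le (x : Site) (i : Fin N) (v : {x // x ∈ Lam n} → Spin N) :
    coordEval n x i v ^ 2 ≤ varBound n * energyForm n N v v :=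
  (sq_apply_le_norm_sq _ i).trans (norm_sq_extZero_le v x)

lemma setLIntegral_increment_le {X : Finset Site} {R H t : ℝ} (hH0 : 0 ≤ H) (ht : 0 < t)
    (hH : gffAux n N Set.univ ≤ ENNReal.ofReal (Real.exp H) * gffAux n N (safeSet n N X R))
    (a b : ℕ) (hab : t * (((a : ℝ) + b) ^ 2 * (8 * π)) ≤ 1 / 2) :
    ∫⁻ v in safeSet n N X R, ENNReal.ofReal
        (∑ x ∈ X, ‖extZero n v (x + ((a : ℤ), (b : ℤ))) - extZero n v x‖ ^ 2) ∂(gffAux n N)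
      ≤ ENNReal.ofReal (32 * varBound n * (X.card * N) + H / t)
        * gffAux n N (safeSet n N X R) := by
  have hK := varBound_pos n
  have hB := isCoerciveForm_energyForm n N
  set O := safeSet n N X R with hO
  set ρ := gffAux n N with hρ
  set f : ({x // x ∈ Lam n} → Spin N) → ℝ :=
    fun v => ∑ x ∈ X, ‖extZero n v (x + ((a : ℤ), (b : ℤ))) - extZero n v x‖ ^ 2 with hf
  have hfm : Measurable f := Finset.measurable_sum _ fun x _ =>
    (((measurable_extZero_apply _).sub (measurable_extZero_apply _)).norm.pow_const 2)
  have hf0 : ∀ v, 0 ≤ f v := fun v => Finset.sum_nonneg fun x _ => sq_nonneg _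
  set l : Site × Fin N → ({x // x ∈ Lam n} → Spin N) →ₗ[ℝ] ℝ :=
    fun j => coordEval n (j.1 + ((a : ℤ), (b : ℤ))) j.2 - coordEval n j.1 j.2 with hl
  have hsum : ∀ v, ∑ j ∈ X ×ˢ Finset.univ, l j v ^ 2 = f v := by
    intro v
    rw [Finset.sum_product]
    refine Finset.sum_congr rfl fun x _ => ?_
    rw [EuclideanSpace.real_norm_sq_eq]
    rfl
  have h1 := lintegral_exp_sum_sq_le (Measure.pi fun _ => (volume : Measure (Spin N))) hB
    (X ×ˢ Finset.univ) l (K := 4 * varBound n) (t := t) (by positivity) ht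
    (fun j _ v => by
      have h2 := coordEval_sq_le (j.1 + ((a : ℤ), (b : ℤ))) j.2 v
      have h3 := coordEval_sq_le j.1 j.2 v
      simp only [hl, LinearMap.sub_apply]
      nlinarith [sq_nonneg (coordEval n (j.1 + ((a : ℤ), (b : ℤ))) j.2 v + coordEval n j.1 j.2 v)])
    (fun v => by
      rw [hsum]
      have h2 : f v ≤ ((a : ℝ) + b) ^ 2 * (8 * π * energyForm n N v v) := by
        rw [energyForm_self]
        exact (vanishesOff_extZero v).sum_increment_sq_le X a b
      calc t * f v ≤ t * (((a : ℝ) + b) ^ 2 * (8 * π * energyForm n N v v)) := by gcongr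
        _ = t * (((a : ℝ) + b) ^ 2 * (8 * π)) * energyForm n N v v := by ring
        _ ≤ 1 / 2 * energyForm n N v v := by
            gcongr
            exact hB.nonneg v
        _ = _ := by ring)
  simp only [hsum] at h1
  have h2 : ∫⁻ v in O, ENNReal.ofReal (Real.exp (t * f v)) ∂ρ
      ≤ ENNReal.ofReal (Real.exp (t * (32 * varBound n * (X.card * N)) + H)) * ρ O := by
    calc ∫⁻ v in O, ENNReal.ofReal (Real.exp (t * f v)) ∂ρ
        ≤ ∫⁻ v, ENNReal.ofReal (Real.exp (t * f v)) ∂ρ := setLIntegral_le_lintegral _ _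
      _ ≤ ENNReal.ofReal (Real.exp (8 * t * (4 * varBound n)
            * ((X ×ˢ (Finset.univ : Finset (Fin N))).card : ℝ))) * ρ Set.univ := by
          rw [lintegral_gffAux (hfm.const_mul t).exp.ennreal_ofReal, hρ, gffAux_univ]
          simp only [mul_comm (gaussWeight _ _)]
          exact h1
      _ ≤ ENNReal.ofReal (Real.exp (8 * t * (4 * varBound n)
            * ((X ×ˢ (Finset.univ : Finset (Fin N))).card : ℝ)))
            * (ENNReal.ofReal (Real.exp H) * ρ O) := by gcongr
      _ = _ := by
          rw [← mul_assoc, ← ENNReal.ofReal_mul (Real.exp_pos _).le, ← Real.exp_add,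
            Finset.card_product, Finset.card_univ, Fintype.card_fin]
          congr 4
          push_cast
          ring
  have h3 := setLIntegral_le_of_exp (hfm.const_mul t) (fun v => mul_nonneg ht.le (hf0 v))
    (by positivity) h2
  simp only [ENNReal.ofReal_mul ht.le] at h3
  rw [lintegral_const_mul _ hfm.ennreal_ofReal] at h3
  have htne : ENNReal.ofReal t ≠ 0 := by simpa using ht
  refine (ENNReal.mul_le_mul_iff_right htne ENNReal.ofReal_ne_top).1 (h3.trans (le_of_eq ?_))
  rw [← mul_assoc (ENNReal.ofReal t), ← ENNReal.ofReal_mul ht.le]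
  congr 2
  field_simp

lemma measure_le_coordEval_le (x : Site) (i : Fin N) (s : ℝ) (hs : s ^ 2 = 1) (a : ℝ) :
    gffAux n N {v | a ≤ s * coordEval n x i v}
      ≤ ENNReal.ofReal (Real.exp (varBound n / 4 - a)) * gffAux n N Set.univ := by
  have h1 := lintegral_exp_linear_le (Measure.pi fun _ => (volume : Measure (Spin N)))
    (isCoerciveForm_energyForm n N) (s • coordEval n x i) (varBound_pos n).le (fun v => by
      rw [LinearMap.smul_apply, smul_eq_mul, mul_pow, hs, one_mul]
      exact coordEval_sq_le x i v)
  have hm : Measurable fun v : {x // x ∈ Lam n} → Spin N =>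
      ENNReal.ofReal (Real.exp ((s • coordEval n x i) v)) :=
    (LinearMap.continuous_of_finiteDimensional _).measurable.exp.ennreal_ofReal
  simp only [mul_comm _ (gaussWeight _ _)] at h1
  rw [← lintegral_gffAux hm, ← gffAux_univ] at h1
  have h2 := mul_meas_ge_le_lintegral (μ := gffAux n N) hm (ENNReal.ofReal (Real.exp a))
  have h3 : {v : {x // x ∈ Lam n} → Spin N | a ≤ s * coordEval n x i v}
      = {v | ENNReal.ofReal (Real.exp a) ≤ ENNReal.ofReal (Real.exp ((s • coordEval n x i) v))} := by
    ext v
    simp [ENNReal.ofReal_le_ofReal_iff (Real.exp_pos _).le]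
  rw [h3]
  calc _ = ENNReal.ofReal (Real.exp (-a)) * (ENNReal.ofReal (Real.exp a) * gffAux n N
          {v | ENNReal.ofReal (Real.exp a)
            ≤ ENNReal.ofReal (Real.exp ((s • coordEval n x i) v))}) := by
        rw [← mul_assoc, ← ENNReal.ofReal_mul (Real.exp_pos _).le, ← Real.exp_add, neg_add_cancel,
          Real.exp_zero, ENNReal.ofReal_one, one_mul]
    _ ≤ ENNReal.ofReal (Real.exp (-a)) * (ENNReal.ofReal (Real.exp (varBound n / 4))
          * gffAux n N Set.univ) := mul_le_mul_right (h2.trans h1) _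
    _ = _ := by
        rw [← mul_assoc, ← ENNReal.ofReal_mul (Real.exp_pos _).le, ← Real.exp_add]
        congr 3
        ring

/-- Configurations whose `i`-th component is at most `a` in absolute value on `X`. -/
def boundedSet (n : ℕ) {N : ℕ} (X : Finset Site) (i : Fin N) (a : ℝ) :
    Set ({x // x ∈ Lam n} → Spin N) :=
  {v | ∀ x ∈ X, |coordEval n x i v| ≤ a}

lemma measurableSet_boundedSet (X : Finset Site) (i : Fin N) (a : ℝ) :
    MeasurableSet (boundedSet n X i a) := by
  have : boundedSet n X i a = ⋂ x ∈ X, {v | |coordEval n x i v| ≤ a} := by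
    ext v; simp [boundedSet]
  rw [this]
  exact X.measurableSet_biInter fun x _ => measurableSet_le
    (LinearMap.continuous_of_finiteDimensional (coordEval n x i)).measurable.norm measurable_const

lemma gffAux_univ_le_boundedSet (X : Finset Site) (i : Fin N) :
    gffAux n N Set.univ ≤ 2 * gffAux n N
      (boundedSet n X i (varBound n / 4 + Real.log (4 * X.card + 1))) := by
  set a := varBound n / 4 + Real.log (4 * X.card + 1) with ha
  set ρ := gffAux n N with hρ
  have hc : (0 : ℝ) < 4 * X.card + 1 := by positivity
  have hexp : Real.exp (varBound n / 4 - a) = (4 * (X.card : ℝ) + 1)⁻¹ := by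
    rw [ha, sub_add_cancel_left, Real.exp_neg, Real.exp_log hc]
  have h1 : ρ (boundedSet n X i a)ᶜ ≤ ENNReal.ofReal (1 / 2) * ρ Set.univ := by
    calc ρ (boundedSet n X i a)ᶜ
        ≤ ρ (⋃ x ∈ X, ({v | a ≤ 1 * coordEval n x i v} ∪ {v | a ≤ (-1) * coordEval n x i v})) := by
          refine measure_mono fun v hv => ?_
          simp only [boundedSet, Set.mem_compl_iff, Set.mem_ofPred_eq, not_forall, not_le,
            lt_abs] at hv
          obtain ⟨x, hx, hv⟩ := hv
          simp only [Set.mem_iUnion]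
          refine ⟨x, hx, ?_⟩
          rcases hv with hv | hv
          · left
            show a ≤ 1 * coordEval n x i v
            linarith
          · right
            show a ≤ (-1) * coordEval n x i v
            linarith
      _ ≤ ∑ x ∈ X, ρ ({v | a ≤ 1 * coordEval n x i v} ∪ {v | a ≤ (-1) * coordEval n x i v}) :=
          measure_biUnion_finset_le _ _
      _ ≤ ∑ x ∈ X, ENNReal.ofReal (2 * (4 * (X.card : ℝ) + 1)⁻¹) * ρ Set.univ := by
          refine Finset.sum_le_sum fun x _ => (measure_union_le _ _).trans ?_
          have h2 := measure_le_coordEval_le (n := n) x i 1 (by norm_num) a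
          have h3 := measure_le_coordEval_le (n := n) x i (-1) (by norm_num) a
          rw [hexp] at h2 h3
          calc _ ≤ _ := add_le_add h2 h3
            _ = _ := by
              rw [← two_mul, ← mul_assoc, ENNReal.ofReal_mul zero_le_two, ENNReal.ofReal_ofNat]
      _ ≤ _ := by
          rw [Finset.sum_const, nsmul_eq_mul, ← mul_assoc, ← ENNReal.ofReal_natCast,
            ← ENNReal.ofReal_mul (by positivity)]
          gcongr
          rw [← mul_assoc, ← div_eq_mul_inv, div_le_div_iff₀ hc two_pos]
          linarith
  have h2 : ρ (boundedSet n X i a) + ρ (boundedSet n X i a)ᶜ = ρ Set.univ :=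
    measure_add_measure_compl (measurableSet_boundedSet X i a)
  have hfin : ρ Set.univ ≠ ∞ := measure_ne_top _ _
  have h3 := ENNReal.toReal_mono (ENNReal.mul_ne_top ENNReal.ofReal_ne_top hfin) h1
  have h4 := congrArg ENNReal.toReal h2
  rw [ENNReal.toReal_mul, ENNReal.toReal_ofReal (by norm_num)] at h3
  rw [ENNReal.toReal_add (measure_ne_top _ _) (measure_ne_top _ _)] at h4
  rw [← ENNReal.toReal_le_toReal hfin (ENNReal.mul_ne_top (by simp) (measure_ne_top _ _)),
    ENNReal.toReal_mul, ENNReal.toReal_ofNat]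
  linarith

lemma two_mul_ofReal (q : ℝ) : (2 : ℝ≥0∞) * ENNReal.ofReal q = ENNReal.ofReal (2 * q) := by
  rw [ENNReal.ofReal_mul zero_le_two, ENNReal.ofReal_ofNat]

/-- Lower bound for the probability of avoiding the ball on `X`. -/
lemma gffAux_univ_le_safeSet {X : Finset Site} (i : Fin N) {R : ℝ} {g : Site → ℝ}
    (hg0 : ∀ x ∉ Lam n, g x = 0) (hg1 : ∀ x ∈ X, g x = 1) {G : ℝ}
    (hG : ∑ x ∈ Lam (n + 4), scalarGradSq g x ≤ 8 * π * G) :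
    gffAux n N Set.univ ≤ ENNReal.ofReal (Real.exp
        (G * (R + (varBound n / 4 + Real.log (4 * X.card + 1))) ^ 2 + 1))
      * gffAux n N (safeSet n N X R) := by
  set a := varBound n / 4 + Real.log (4 * X.card + 1) with ha
  set u := R + a with hu
  set e : Spin N := EuclideanSpace.single i 1 with he
  set φ : Conf N := fun x => (u * g x) • e with hφ
  have hφ0 : VanishesOff n φ := fun x hx => by simp [hφ, hg0 x hx]
  set k : {x // x ∈ Lam n} → Spin N := fun x => φ x with hk
  have hkφ : extZero n k = φ := extZero_restrict hφ0
  have hBk : energyForm n N k k ≤ G * u ^ 2 := by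
    have hpi := Real.pi_pos
    have h1 := sum_gradSq_eq n φ
    have h2 : ∀ x, gradSq φ x = u ^ 2 * scalarGradSq g x := by
      intro x
      simp only [gradSq, hφ, ← sub_smul, ← mul_sub, norm_smul, scalarGradSq, he,
        PiLp.norm_single, norm_one, mul_one, Real.norm_eq_abs, sq_abs]
      ring
    simp only [h2, ← Finset.mul_sum] at h1
    rw [energyForm_self, hkφ]
    have h3 : 8 * π * dirEnergy n N φ ≤ 8 * π * (G * u ^ 2) := by
      rw [← h1]
      calc u ^ 2 * ∑ x ∈ Lam (n + 4), scalarGradSq g x ≤ u ^ 2 * (8 * π * G) := by gcongr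
        _ = _ := by ring
    exact le_of_mul_le_mul_left h3 (by positivity)
  have h1 := setLIntegral_gaussWeight_shift_ge (Measure.pi fun _ => (volume : Measure (Spin N)))
    (isCoerciveForm_energyForm n N) (measurableSet_boundedSet X i a) (measurableSet_safeSet X R)
    (fun v hv x hx => by rw [map_neg, abs_neg]; exact hv x hx) k
    (fun v hv x hx => by
      have h2 := (abs_le.1 (hv x hx)).1
      have h3 : extZero n (v + k) x i = coordEval n x i v + u := by
        rw [extZero_add, hkφ]
        simp [hφ, he, hg1 x hx, coordEval_apply]
      have h4 : |extZero n (v + k) x i| ≤ ‖extZero n (v + k) x‖ :=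
        abs_le_of_sq_le_sq (sq_apply_le_norm_sq _ i) (norm_nonneg _)
      have h5 := le_abs_self (extZero n (v + k) x i)
      linarith)
  have hset : ∀ A : Set ({x // x ∈ Lam n} → Spin N), MeasurableSet A →
      ∫⁻ v in A, gaussWeight (energyForm n N) v
        ∂(Measure.pi fun _ => (volume : Measure (Spin N))) = gffAux n N A := by
    intro A hA
    rw [gffAux_eq, withDensity_apply _ hA]
  rw [hset _ (measurableSet_boundedSet X i a), hset _ (measurableSet_safeSet X R)] at h1
  calc gffAux n N Set.univ ≤ 2 * gffAux n N (boundedSet n X i a) := gffAux_univ_le_boundedSet X i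
    _ = 2 * ENNReal.ofReal (Real.exp (energyForm n N k k))
          * (ENNReal.ofReal (Real.exp (-(energyForm n N k k))) * gffAux n N (boundedSet n X i a)) := by
        rw [mul_assoc, ← mul_assoc (ENNReal.ofReal _), ← ENNReal.ofReal_mul (Real.exp_pos _).le,
          ← Real.exp_add, add_neg_cancel, Real.exp_zero, ENNReal.ofReal_one, one_mul]
    _ ≤ 2 * ENNReal.ofReal (Real.exp (energyForm n N k k)) * gffAux n N (safeSet n N X R) := by
        gcongr
    _ ≤ _ := by
        rw [two_mul_ofReal]
        gcongr
        rw [Real.exp_add, mul_comm]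
        gcongr
        have := Real.add_one_le_exp 1
        linarith

end Estimates

section Geometry

variable {D : Set (ℝ × ℝ)} {ι : ℝ} {n : ℕ}

lemma frontier_unitSq : frontier unitSq =
    Set.Icc (-(1 / 2 : ℝ)) (1 / 2) ×ˢ {-(1 / 2 : ℝ), 1 / 2}
      ∪ {-(1 / 2 : ℝ), 1 / 2} ×ˢ Set.Icc (-(1 / 2 : ℝ)) (1 / 2) := by
  have h : unitSq = Set.Icc (-(1 / 2 : ℝ)) (1 / 2) ×ˢ Set.Icc (-(1 / 2 : ℝ)) (1 / 2) := by
    rw [unitSq, Set.Icc_prod_eq]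
  rw [h, frontier_prod_eq, frontier_Icc (by norm_num), isClosed_Icc.closure_eq]

lemma abs_le_of_dist_frontier (hDsub : D ⊆ unitSq)
    (hdist : ∀ p ∈ D, ∀ q ∈ frontier unitSq, ι ≤ dist p q) {p : ℝ × ℝ} (hp : p ∈ D) :
    |p.1| ≤ 1 / 2 - ι ∧ |p.2| ≤ 1 / 2 - ι := by
  obtain ⟨⟨h1, h2⟩, h3, h4⟩ := hDsub hp
  simp only at h1 h2 h3 h4
  have hd : ∀ a b : ℝ, (a, b) ∈ frontier unitSq → ι ≤ max |p.1 - a| |p.2 - b| := fun a b hab => by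
    have := hdist p hp (a, b) hab
    rwa [Prod.dist_eq, Real.dist_eq, Real.dist_eq] at this
  rw [frontier_unitSq] at hd
  have e1 := hd (1 / 2) p.2 (Or.inr ⟨by simp, h2, h4⟩)
  have e2 := hd (-(1 / 2)) p.2 (Or.inr ⟨by simp, h2, h4⟩)
  have e3 := hd p.1 (1 / 2) (Or.inl ⟨⟨h1, h3⟩, by simp⟩)
  have e4 := hd p.1 (-(1 / 2)) (Or.inl ⟨⟨h1, h3⟩, by simp⟩)
  simp only [sub_self, abs_zero, abs_nonneg, sup_of_le_left, sup_of_le_right] at e1 e2 e3 e4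
  rw [abs_of_nonpos (by linarith)] at e1 e3
  rw [abs_of_nonneg (by linarith)] at e2 e4
  exact ⟨abs_le.2 ⟨by linarith, by linarith⟩, abs_le.2 ⟨by linarith, by linarith⟩⟩

lemma siteNorm_cast (x : Site) : (siteNorm x : ℝ) = max |(x.1 : ℝ)| |(x.2 : ℝ)| := by
  simp [siteNorm, Nat.cast_natAbs]

lemma siteNorm_le_of_mem_Dn (hDsub : D ⊆ unitSq)
    (hdist : ∀ p ∈ D, ∀ q ∈ frontier unitSq, ι ≤ dist p q) (hn : 1 ≤ n) {x : Site}
    (hx : x ∈ Dn D n) : (siteNorm x : ℝ) ≤ (1 / 2 - ι) * n := by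
  have hn' : (0 : ℝ) < n := by exact_mod_cast hn
  obtain ⟨h1, h2⟩ := abs_le_of_dist_frontier hDsub hdist hx
  simp only [abs_div, Nat.abs_cast, div_le_iff₀ hn'] at h1 h2
  rw [siteNorm_cast]
  exact max_le h1 h2

lemma mem_Lam_iff_siteNorm {x : Site} : x ∈ Lam n ↔ (siteNorm x : ℝ) ≤ n / 2 := by
  rw [siteNorm_cast, max_le_iff, le_div_iff₀ two_pos, le_div_iff₀ two_pos, mem_Lam_iff]
  have h : ∀ a : ℤ, |(a : ℝ)| * 2 ≤ n ↔ -(n : ℤ) ≤ 2 * a ∧ 2 * a ≤ n := fun a => by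
    rw [← Int.cast_abs]
    have : |a| * 2 ≤ (n : ℤ) ↔ -(n : ℤ) ≤ 2 * a ∧ 2 * a ≤ n := by
      constructor
      · intro h
        constructor <;> cases abs_cases a <;> omega
      · rintro ⟨h1, h2⟩
        cases abs_cases a <;> omega
    rw [← this]
    exact_mod_cast Iff.rfl
  rw [h, h]

lemma siteNorm_add_le (x y : Site) : siteNorm (x + y) ≤ siteNorm x + siteNorm y := by
  simp only [siteNorm, Prod.fst_add, Prod.snd_add]
  omega

lemma Dn_subset_Lam (hDsub : D ⊆ unitSq) (hι : 0 < ι)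
    (hdist : ∀ p ∈ D, ∀ q ∈ frontier unitSq, ι ≤ dist p q) (hn : 1 ≤ n) :
    Dn D n ⊆ Lam n := by
  intro x hx
  have hn' : (0 : ℝ) < n := by exact_mod_cast hn
  have := siteNorm_le_of_mem_Dn hDsub hdist hn hx
  rw [Finset.mem_coe, mem_Lam_iff_siteNorm]
  nlinarith [mul_pos hι hn']

lemma isDeep_of_mem_Dn (hDsub : D ⊆ unitSq)
    (hdist : ∀ p ∈ D, ∀ q ∈ frontier unitSq, ι ≤ dist p q) (hn : 1 ≤ n) {r : ℕ}
    (hr : (r : ℝ) ≤ ι * n) {c : Site} (hc : c ∈ Dn D n) : IsDeep n r c := by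
  intro x hx
  have h1 := siteNorm_le_of_mem_Dn hDsub hdist hn hc
  have h2 : siteNorm x ≤ siteNorm (x - c) + siteNorm c := by
    simpa using siteNorm_add_le (x - c) c
  have h3 : (siteNorm x : ℝ) ≤ r + siteNorm c := by
    exact_mod_cast h2.trans (Nat.add_le_add_right hx.le _)
  rw [mem_Lam_iff_siteNorm]
  linarith

lemma card_Lam_le (n : ℕ) : (Lam n).card ≤ (2 * n + 1) ^ 2 := by
  refine (Finset.card_filter_le _ _).trans (le_of_eq ?_)
  rw [Finset.card_product, Int.card_Icc, sq]
  congr 1 <;> omega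

/-- The linear cutoff between the boundary of `Λ_n` and distance `ι n` from it. -/
def boxCutoff (n : ℕ) (ι : ℝ) (x : Site) : ℝ := min 1 (max 0 ((n / 2 - siteNorm x) / (ι * n)))

lemma boxCutoff_eq_zero (hι : 0 < ι) {x : Site} (hx : x ∉ Lam n) : boxCutoff n ι x = 0 := by
  rw [mem_Lam_iff_siteNorm, not_le] at hx
  have : (n / 2 - siteNorm x) / (ι * n) ≤ 0 :=
    div_nonpos_of_nonpos_of_nonneg (by linarith) (by positivity)
  rw [boxCutoff, max_eq_left this, min_eq_right zero_le_one]

lemma boxCutoff_eq_one (hDsub : D ⊆ unitSq) (hι : 0 < ι)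
    (hdist : ∀ p ∈ D, ∀ q ∈ frontier unitSq, ι ≤ dist p q) (hn : 1 ≤ n) {x : Site}
    (hx : x ∈ Dn D n) : boxCutoff n ι x = 1 := by
  have hn' : (0 : ℝ) < n := by exact_mod_cast hn
  have h1 := siteNorm_le_of_mem_Dn hDsub hdist hn hx
  have : 1 ≤ (n / 2 - siteNorm x) / (ι * n) := by
    rw [le_div_iff₀ (by positivity)]
    linarith
  exact min_eq_left (this.trans (le_max_right _ _))

lemma abs_boxCutoff_sub_le (hι : 0 < ι) (hn : 1 ≤ n) {x y : Site}
    (hxy : siteNorm (y - x) ≤ 1) :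
    (boxCutoff n ι x - boxCutoff n ι y) ^ 2 ≤ 1 / (ι * n) ^ 2 := by
  have hn' : (0 : ℝ) < n := by exact_mod_cast hn
  have hc : 0 < ι * n := by positivity
  have h1 : siteNorm x ≤ siteNorm y + 1 := by
    simp only [siteNorm, Prod.fst_sub, Prod.snd_sub] at *
    omega
  have h2 : siteNorm y ≤ siteNorm x + 1 := by
    simp only [siteNorm, Prod.fst_sub, Prod.snd_sub] at *
    omega
  have h1' : (siteNorm x : ℝ) ≤ siteNorm y + 1 := by exact_mod_cast h1
  have h2' : (siteNorm y : ℝ) ≤ siteNorm x + 1 := by exact_mod_cast h2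
  have h3 : |boxCutoff n ι x - boxCutoff n ι y|
      ≤ |(n / 2 - siteNorm x) / (ι * n) - (n / 2 - siteNorm y) / (ι * n)| := by
    refine (abs_min_sub_min_le_max _ _ _ _).trans (max_le (by simp) ?_)
    exact (abs_max_sub_max_le_max _ _ _ _).trans (max_le (by simp) le_rfl)
  have h4 : |(n / 2 - siteNorm x) / (ι * n) - (n / 2 - siteNorm y) / (ι * n)| ≤ 1 / (ι * n) := by
    rw [← sub_div, abs_div, abs_of_pos hc]
    gcongr
    exact abs_le.2 ⟨by linarith, by linarith⟩
  rw [← sq_abs, ← one_div_pow]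
  exact pow_le_pow_left₀ (abs_nonneg _) (h3.trans h4) 2

lemma sum_scalarGradSq_boxCutoff_le (hι : 0 < ι) (hn : 1 ≤ n) :
    ∑ x ∈ Lam (n + 4), scalarGradSq (boxCutoff n ι) x ≤ 242 / ι ^ 2 := by
  have hn' : (1 : ℝ) ≤ n := by exact_mod_cast hn
  have h1 : ∀ x ∈ Lam (n + 4), scalarGradSq (boxCutoff n ι) x ≤ 2 / (ι * n) ^ 2 := fun x _ => by
    have e1 := abs_boxCutoff_sub_le hι hn (x := x) (y := x + (1, 0)) (by simp [siteNorm])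
    have e2 := abs_boxCutoff_sub_le hι hn (x := x) (y := x + (0, 1)) (by simp [siteNorm])
    calc scalarGradSq (boxCutoff n ι) x ≤ 1 / (ι * n) ^ 2 + 1 / (ι * n) ^ 2 := add_le_add e1 e2
      _ = _ := by ring
  have h2 : ((Lam (n + 4)).card : ℝ) ≤ (11 * n) ^ 2 := by
    calc ((Lam (n + 4)).card : ℝ) ≤ (2 * (n + 4) + 1) ^ 2 := by exact_mod_cast card_Lam_le (n + 4)
      _ ≤ _ := pow_le_pow_left₀ (by positivity) (by linarith) 2
  calc _ ≤ (Lam (n + 4)).card • (2 / (ι * n) ^ 2) := Finset.sum_le_card_nsmul _ _ _ h1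
    _ ≤ (11 * n) ^ 2 * (2 / (ι * n) ^ 2) := by rw [nsmul_eq_mul]; gcongr
    _ = _ := by field_simp; norm_num

/-- The sites of `D_n` as a finite set. -/
def domSites (D : Set (ℝ × ℝ)) (n : ℕ) : Finset Site := (Lam n).filter (· ∈ Dn D n)

lemma coe_domSites (hDsub : D ⊆ unitSq) (hι : 0 < ι)
    (hdist : ∀ p ∈ D, ∀ q ∈ frontier unitSq, ι ≤ dist p q) (hn : 1 ≤ n) :
    (domSites D n : Set Site) = Dn D n := by
  ext x
  simp only [domSites, Finset.coe_filter, Set.mem_ofPred_eq, and_iff_right_iff_imp]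
  exact fun hx => Dn_subset_Lam hDsub hι hdist hn hx

lemma card_domSites_le (hn : 1 ≤ n) : ((domSites D n).card : ℝ) ≤ 9 * n ^ 2 := by
  have hn' : (1 : ℝ) ≤ n := by exact_mod_cast hn
  calc ((domSites D n).card : ℝ) ≤ (2 * n + 1) ^ 2 := by
        exact_mod_cast (Finset.card_filter_le _ _).trans (card_Lam_le n)
    _ ≤ (3 * n) ^ 2 := pow_le_pow_left₀ (by positivity) (by linarith) 2
    _ = _ := by ring

end Geometry

section Alignment

lemma one_sub_inner_normalize_le {E : Type*} [NormedAddCommGroup E] [InnerProductSpace ℝ E]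
    (u v : E) (hu : u ≠ 0) :
    1 - inner ℝ (‖u‖⁻¹ • u) (‖v‖⁻¹ • v) ≤ 2 * ‖u - v‖ ^ 2 / ‖u‖ ^ 2 := by
  have ha : 0 < ‖u‖ := norm_pos_iff.2 hu
  rw [le_div_iff₀ (by positivity), real_inner_smul_left, real_inner_smul_right,
    norm_sub_sq_real]
  rcases eq_or_ne v 0 with rfl | hv
  · simp
    nlinarith [sq_nonneg ‖u‖]
  have hb : 0 < ‖v‖ := norm_pos_iff.2 hv
  have hc := neg_le_of_abs_le (abs_real_inner_le_norm u v)
  have hc' := real_inner_le_norm u v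
  set a := ‖u‖
  set b := ‖v‖
  set c : ℝ := inner ℝ u v
  have h1 : (1 - a⁻¹ * (b⁻¹ * c)) * a ^ 2 = a * (a * b - c) / b := by
    field_simp
  rw [h1, div_le_iff₀ hb]
  rcases le_total a (4 * b) with h | h
  · nlinarith [mul_nonneg (sub_nonneg.2 h) (sub_nonneg.2 hc'), mul_nonneg hb.le (sq_nonneg (a - b))]
  · nlinarith [mul_nonneg (sub_nonneg.2 h) (by linarith : 0 ≤ a * b + c), mul_pos ha hb,
      mul_nonneg hb.le (sq_nonneg (a - b)), mul_pos (mul_pos hb hb) hb,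
      mul_nonneg hb.le (mul_nonneg hb.le (sub_nonneg.2 h))]

lemma one_sub_inner_normalize_le_two {E : Type*} [NormedAddCommGroup E] [InnerProductSpace ℝ E]
    (u v : E) : |inner ℝ (‖u‖⁻¹ • u) (‖v‖⁻¹ • v)| ≤ 1 := by
  have h : ∀ w : E, ‖‖w‖⁻¹ • w‖ ≤ 1 := fun w => by
    rw [norm_smul, norm_inv, norm_norm]
    exact inv_mul_le_one
  exact (abs_real_inner_le_norm _ _).trans (mul_le_one₀ (h u) (norm_nonneg _) (h v))

/-- A function on pairs of sites whose averages over square windows based at `x` and `y` are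
small is small at `(x, y)` when the windows overlap substantially. -/
lemma le_of_window_sum_le {A : Site → Site → ℝ≥0∞}
    (hA : ∀ x y z, A x y ≤ 2 * A x z + 2 * A y z) {L : ℕ} (hL : 1 ≤ L) {K : ℝ≥0∞} {x y : Site}
    (h1 : |x.1 - y.1| ≤ L) (h2 : |x.2 - y.2| ≤ L)
    (hx : ∑ h ∈ Finset.range (2 * L) ×ˢ Finset.range (2 * L), A x (x + ((h.1 : ℤ), (h.2 : ℤ)))
      ≤ 4 * (L : ℝ≥0∞) ^ 2 * K)
    (hy : ∑ h ∈ Finset.range (2 * L) ×ˢ Finset.range (2 * L), A y (y + ((h.1 : ℤ), (h.2 : ℤ)))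
      ≤ 4 * (L : ℝ≥0∞) ^ 2 * K) :
    A x y ≤ 16 * K := by
  set z : ℕ × ℕ → Site := fun k => (max x.1 y.1 + k.1, max x.2 y.2 + k.2) with hz
  have key : ∀ w : Site, (w = x ∨ w = y) →
      ∑ k ∈ Finset.range L ×ˢ Finset.range L, A w (z k)
        ≤ ∑ h ∈ Finset.range (2 * L) ×ˢ Finset.range (2 * L), A w (w + ((h.1 : ℤ), (h.2 : ℤ))) := by
    intro w hw
    have hw1 : 0 ≤ max x.1 y.1 - w.1 ∧ max x.1 y.1 - w.1 ≤ L := by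
      rcases hw with hw | hw <;> rw [hw] <;> cases abs_cases (x.1 - y.1) <;> omega
    have hw2 : 0 ≤ max x.2 y.2 - w.2 ∧ max x.2 y.2 - w.2 ≤ L := by
      rcases hw with hw | hw <;> rw [hw] <;> cases abs_cases (x.2 - y.2) <;> omega
    obtain ⟨o1, ho1⟩ := Int.eq_ofNat_of_zero_le hw1.1
    obtain ⟨o2, ho2⟩ := Int.eq_ofNat_of_zero_le hw2.1
    have hinj : Set.InjOn (fun k : ℕ × ℕ => (o1 + k.1, o2 + k.2))
        (Finset.range L ×ˢ Finset.range L : Finset (ℕ × ℕ)) := by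
      rintro ⟨k1, k2⟩ _ ⟨l1, l2⟩ _ h
      simp only [Prod.mk.injEq] at h ⊢
      omega
    calc ∑ k ∈ Finset.range L ×ˢ Finset.range L, A w (z k)
        = ∑ k ∈ Finset.range L ×ˢ Finset.range L,
            A w (w + (((o1 + k.1 : ℕ) : ℤ), ((o2 + k.2 : ℕ) : ℤ))) := by
          refine Finset.sum_congr rfl fun k _ => ?_
          congr 1
          ext <;> simp [hz] <;> omega
      _ = ∑ h ∈ (Finset.range L ×ˢ Finset.range L).image
            (fun k : ℕ × ℕ => (o1 + k.1, o2 + k.2)), A w (w + ((h.1 : ℤ), (h.2 : ℤ))) :=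
          (Finset.sum_image (f := fun h : ℕ × ℕ => A w (w + ((h.1 : ℤ), (h.2 : ℤ)))) hinj).symm
      _ ≤ _ := by
          refine Finset.sum_le_sum_of_subset fun h hh => ?_
          simp only [Finset.mem_image, Finset.mem_product, Finset.mem_range] at hh ⊢
          obtain ⟨k, hk, rfl⟩ := hh
          simp only
          omega
  have hLpos : (L : ℝ≥0∞) ^ 2 ≠ 0 := by
    have : (L : ℝ≥0∞) ≠ 0 := by exact_mod_cast (by omega : L ≠ 0)
    exact pow_ne_zero _ this
  have hLtop : (L : ℝ≥0∞) ^ 2 ≠ ∞ := ENNReal.pow_ne_top (ENNReal.natCast_ne_top L)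
  refine (ENNReal.mul_le_mul_iff_right hLpos hLtop).1 ?_
  calc (L : ℝ≥0∞) ^ 2 * A x y = ∑ k ∈ Finset.range L ×ˢ Finset.range L, A x y := by
        rw [Finset.sum_const, Finset.card_product, Finset.card_range, nsmul_eq_mul]
        push_cast
        ring
    _ ≤ ∑ k ∈ Finset.range L ×ˢ Finset.range L, (2 * A x (z k) + 2 * A y (z k)) :=
        Finset.sum_le_sum fun k _ => hA x y (z k)
    _ = 2 * ∑ k ∈ Finset.range L ×ˢ Finset.range L, A x (z k)
          + 2 * ∑ k ∈ Finset.range L ×ˢ Finset.range L, A y (z k) := by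
        rw [Finset.sum_add_distrib, Finset.mul_sum, Finset.mul_sum]
    _ ≤ 2 * (4 * (L : ℝ≥0∞) ^ 2 * K) + 2 * (4 * (L : ℝ≥0∞) ^ 2 * K) := by
        gcongr
        · exact (key x (Or.inl rfl)).trans hx
        · exact (key y (Or.inr rfl)).trans hy
    _ = (L : ℝ≥0∞) ^ 2 * (16 * K) := by ring

lemma card_filter_lt_mul_le {α : Type*} (X : Finset α) (a : α → ℝ≥0∞) {K : ℝ}
    {B : ℝ} (hB : 0 ≤ B) (h : ∑ x ∈ X, a x ≤ ENNReal.ofReal B) :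
    ((X.filter fun x => ENNReal.ofReal K < a x).card : ℝ) * K ≤ B := by
  rw [← ENNReal.ofReal_le_ofReal_iff hB, ENNReal.ofReal_mul (by positivity),
    ENNReal.ofReal_natCast, ← nsmul_eq_mul]
  calc _ ≤ ∑ x ∈ X.filter fun x => ENNReal.ofReal K < a x, a x :=
        Finset.card_nsmul_le_sum _ _ _ fun x hx => (Finset.mem_filter.1 hx).2.le
    _ ≤ ∑ x ∈ X, a x := Finset.sum_le_sum_of_subset (Finset.filter_subset _ _)
    _ ≤ _ := h

lemma le_integral_inner_normalize {Ω E : Type*} [MeasurableSpace Ω] {Q : Measure Ω}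
    [IsProbabilityMeasure Q] [NormedAddCommGroup E] [InnerProductSpace ℝ E]
    [MeasurableSpace E] [BorelSpace E] [SecondCountableTopology E] {U V : Ω → E}
    (hU : Measurable U) (hV : Measurable V) {S K β : ℝ} (hS : 0 < S) (hK : 0 ≤ K) (hβ : 0 ≤ β)
    (hK' : ∫⁻ ω, ENNReal.ofReal (‖U ω - V ω‖ ^ 2) ∂Q ≤ ENNReal.ofReal K)
    (hβ' : Q {ω | ‖U ω‖ ≤ S} ≤ ENNReal.ofReal β) :
    1 - (2 / S ^ 2 * K + 2 * β)
      ≤ ∫ ω, inner ℝ (‖U ω‖⁻¹ • U ω) (‖V ω‖⁻¹ • V ω) ∂Q := by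
  set g : Ω → ℝ := fun ω => inner ℝ (‖U ω‖⁻¹ • U ω) (‖V ω‖⁻¹ • V ω) with hg
  have hgm : Measurable g := (hU.norm.inv.smul hU).inner (hV.norm.inv.smul hV)
  have hg1 : ∀ ω, |g ω| ≤ 1 := fun ω => one_sub_inner_normalize_le_two _ _
  have hgi : Integrable g Q := Integrable.of_bound hgm.aestronglyMeasurable 1
    (Eventually.of_forall hg1)
  have hset : MeasurableSet {ω | ‖U ω‖ ≤ S} := measurableSet_le hU.norm measurable_const
  have hm : Measurable fun ω => ENNReal.ofReal (‖U ω - V ω‖ ^ 2) :=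
    ((hU.sub hV).norm.pow_const 2).ennreal_ofReal
  have h1 : ENNReal.ofReal (∫ ω, (1 - g ω) ∂Q) ≤ ENNReal.ofReal (2 / S ^ 2 * K + 2 * β) := by
    have hgi' : Integrable (fun ω => 1 - g ω) Q := (integrable_const 1).sub hgi
    rw [ofReal_integral_eq_lintegral_ofReal hgi' (Eventually.of_forall fun ω => by
        have := (abs_le.1 (hg1 ω)).2
        simpa using this)]
    calc ∫⁻ ω, ENNReal.ofReal (1 - g ω) ∂Q
        ≤ ∫⁻ ω, (ENNReal.ofReal (2 / S ^ 2) * ENNReal.ofReal (‖U ω - V ω‖ ^ 2)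
            + {ω | ‖U ω‖ ≤ S}.indicator (fun _ => ENNReal.ofReal 2) ω) ∂Q := by
          refine lintegral_mono fun ω => ?_
          by_cases hω : ‖U ω‖ ≤ S
          · rw [Set.indicator_of_mem (by exact hω)]
            refine le_add_left (ENNReal.ofReal_le_ofReal ?_)
            linarith [(abs_le.1 (hg1 ω)).1]
          · rw [Set.indicator_of_notMem (by exact hω), add_zero,
              ← ENNReal.ofReal_mul (by positivity)]
            refine ENNReal.ofReal_le_ofReal ?_
            have hpos : 0 < ‖U ω‖ := hS.trans (not_le.1 hω)
            refine (one_sub_inner_normalize_le _ _ (norm_pos_iff.1 hpos)).trans ?_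
            rw [mul_div_right_comm]
            gcongr
            exact (not_le.1 hω).le
      _ = ENNReal.ofReal (2 / S ^ 2) * ∫⁻ ω, ENNReal.ofReal (‖U ω - V ω‖ ^ 2) ∂Q
            + ENNReal.ofReal 2 * Q {ω | ‖U ω‖ ≤ S} := by
          rw [lintegral_add_left (hm.const_mul _), lintegral_const_mul _ hm,
            lintegral_indicator_const hset]
      _ ≤ ENNReal.ofReal (2 / S ^ 2) * ENNReal.ofReal K + ENNReal.ofReal 2 * ENNReal.ofReal β := by
          gcongr
      _ = _ := by
          rw [← ENNReal.ofReal_mul (by positivity), ← ENNReal.ofReal_mul zero_le_two,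
            ← ENNReal.ofReal_add (by positivity) (by positivity)]
  rw [ENNReal.ofReal_le_ofReal_iff (by positivity), integral_sub (integrable_const 1) hgi] at h1
  simp only [integral_const, probReal_univ, smul_eq_mul, mul_one] at h1
  linarith

end Alignment

section Conditioning

variable {n N : ℕ}

lemma measurable_extZero : Measurable (extZero n : ({x // x ∈ Lam n} → Spin N) → Conf N) :=
  measurable_pi_iff.2 measurable_extZero_apply

/-- The free field conditioned on avoiding the ball of radius `R` on `X`. -/
def avoidGff (n N : ℕ) (X : Finset Site) (R : ℝ) : Measure ({x // x ∈ Lam n} → Spin N) :=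
  (gffAux n N (safeSet n N X R))⁻¹ • (gffAux n N).restrict (safeSet n N X R)

lemma isProbabilityMeasure_avoidGff {X : Finset Site} {R : ℝ}
    (h0 : gffAux n N (safeSet n N X R) ≠ 0) : IsProbabilityMeasure (avoidGff n N X R) :=
  ⟨by rw [avoidGff, Measure.smul_apply, Measure.restrict_apply_univ, smul_eq_mul,
    ENNReal.inv_mul_cancel h0 (measure_ne_top _ _)]⟩

lemma condExpOn_gff_avoids {X : Finset Site} {R : ℝ} {f : Conf N → ℝ} (hf : Measurable f) :
    condExpOn (gff n N) (avoids (X : Set Site) (Metric.ball (0 : Spin N) R)) f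
      = ∫ v, f (extZero n v) ∂(avoidGff n N X R) := by
  have hA : MeasurableSet (avoids (X : Set Site) (Metric.ball (0 : Spin N) R)) := by
    have : avoids (X : Set Site) (Metric.ball (0 : Spin N) R)
        = ⋂ x ∈ X, (fun φ : Conf N => φ x) ⁻¹' (Metric.ball (0 : Spin N) R)ᶜ := by
      ext; simp [avoids]
    rw [this]
    exact X.measurableSet_biInter fun x _ =>
      (measurable_pi_apply x) Metric.isOpen_ball.measurableSet.compl
  have hpre : extZero n ⁻¹' (avoids (X : Set Site) (Metric.ball (0 : Spin N) R))
      = safeSet n N X R := by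
    ext v
    simp [avoids, safeSet]
  have h0 : gffAux n N Set.univ ≠ 0 := gffAux_univ_ne_zero
  have hc : (gffAux n N Set.univ)⁻¹.toReal ≠ 0 :=
    (ENNReal.toReal_pos (ENNReal.inv_ne_zero.2 (measure_ne_top _ _))
      (ENNReal.inv_ne_top.2 h0)).ne'
  rw [condExpOn, gff, Measure.restrict_smul, integral_smul_measure, Measure.smul_apply,
    Measure.map_apply measurable_extZero hA,
    setIntegral_map hA hf.aestronglyMeasurable measurable_extZero.aemeasurable, hpre, avoidGff,
    integral_smul_measure, smul_eq_mul, smul_eq_mul, smul_eq_mul, ENNReal.toReal_mul,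
    mul_div_mul_left _ _ hc, ENNReal.toReal_inv, div_eq_inv_mul]

end Conditioning

section Asymptotics

variable {N : ℕ} {D : Set (ℝ × ℝ)} {ι R : ℝ}

lemma one_le_log_natCast {n : ℕ} (hn : 3 ≤ n) : 1 ≤ Real.log n := by
  rw [Real.le_log_iff_exp_le (by positivity)]
  have h3 : (3 : ℝ) ≤ n := by exact_mod_cast hn
  linarith [Real.exp_one_lt_d9]

lemma varBound_le {n : ℕ} (hn : 3 ≤ n) : varBound n ≤ 32 * π * Real.log n := by
  have h1 := one_le_log_natCast hn
  have h3 : (3 : ℝ) ≤ n := by exact_mod_cast hn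
  have h2 : (harmonic (2 * n + 1) : ℝ) ≤ 4 * Real.log n := by
    refine (harmonic_le_one_add_log _).trans ?_
    have h4 : Real.log ((2 * n + 1 : ℕ) : ℝ) ≤ Real.log (3 * n) := by
      apply Real.log_le_log (by positivity)
      push_cast
      linarith
    rw [Real.log_mul (by norm_num) (by positivity)] at h4
    have h5 := Real.log_le_sub_one_of_pos (show (0 : ℝ) < 3 by norm_num)
    linarith
  calc varBound n ≤ 8 * π * (4 * Real.log n) := by
        unfold varBound
        have := Real.pi_pos
        gcongr
    _ = _ := by ring

/-- The logarithmic cost of avoiding the ball of radius `R` on `D_n`. -/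
def avoidCost (D : Set (ℝ × ℝ)) (ι R : ℝ) (n : ℕ) : ℝ :=
  242 / ι ^ 2 / (8 * π) * (R + (varBound n / 4 + Real.log (4 * (domSites D n).card + 1))) ^ 2 + 1

lemma avoidCost_nonneg (n : ℕ) : 0 ≤ avoidCost D ι R n := by
  have := Real.pi_pos
  unfold avoidCost
  positivity

lemma exists_avoidCost_le (hR : 0 < R) :
    ∃ C, 0 < C ∧ ∀ n : ℕ, 3 ≤ n → avoidCost D ι R n ≤ C * Real.log n ^ 2 := by
  have hpi := Real.pi_pos
  refine ⟨242 / ι ^ 2 / (8 * π) * (R + (8 * π + 38)) ^ 2 + 1, by positivity, fun n hn => ?_⟩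
  have h1 := one_le_log_natCast hn
  have h3 : (3 : ℝ) ≤ n := by exact_mod_cast hn
  have hv := varBound_le hn
  have hv0 := (varBound_pos n).le
  have h4 : Real.log (4 * (domSites D n).card + 1) ≤ 38 * Real.log n := by
    have h5 : Real.log (4 * (domSites D n).card + 1) ≤ Real.log (37 * (n : ℝ) ^ 2) := by
      apply Real.log_le_log (by positivity)
      have := card_domSites_le (D := D) (n := n) (by omega)
      nlinarith
    rw [Real.log_mul (by norm_num) (by positivity), Real.log_pow] at h5
    have h6 := Real.log_le_sub_one_of_pos (show (0 : ℝ) < 37 by norm_num)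
    push_cast at h5
    linarith
  have h7 : 0 ≤ Real.log (4 * ((domSites D n).card : ℝ) + 1) := Real.log_nonneg (by simp)
  have h8 : (R + (varBound n / 4 + Real.log (4 * (domSites D n).card + 1))) ^ 2
      ≤ ((R + (8 * π + 38)) * Real.log n) ^ 2 := by
    apply pow_le_pow_left₀ (by positivity)
    nlinarith
  calc avoidCost D ι R n
      ≤ 242 / ι ^ 2 / (8 * π) * ((R + (8 * π + 38)) * Real.log n) ^ 2 + Real.log n ^ 2 := by
        unfold avoidCost
        gcongr
        nlinarith
    _ = _ := by ring

lemma gffAux_univ_le_domSites (hN : 2 ≤ N) (hDsub : D ⊆ unitSq) (hι : 0 < ι)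
    (hdist : ∀ p ∈ D, ∀ q ∈ frontier unitSq, ι ≤ dist p q) {n : ℕ} (hn : 1 ≤ n) :
    gffAux n N Set.univ ≤ ENNReal.ofReal (Real.exp (avoidCost D ι R n))
      * gffAux n N (safeSet n N (domSites D n) R) := by
  have hpi := Real.pi_pos
  refine gffAux_univ_le_safeSet ⟨0, by omega⟩ (g := boxCutoff n ι)
    (fun x hx => boxCutoff_eq_zero hι hx) (fun x hx => ?_) ?_
  · exact boxCutoff_eq_one hDsub hι hdist hn (Finset.mem_filter.1 hx).2
  · rw [mul_div_cancel₀ _ (by positivity)]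
    exact sum_scalarGradSq_boxCutoff_le hι hn

lemma gffAux_safeSet_ne_zero (hN : 2 ≤ N) (hDsub : D ⊆ unitSq) (hι : 0 < ι)
    (hdist : ∀ p ∈ D, ∀ q ∈ frontier unitSq, ι ≤ dist p q) {n : ℕ} (hn : 1 ≤ n) :
    gffAux n N (safeSet n N (domSites D n) R) ≠ 0 := by
  intro h0
  have h := gffAux_univ_le_domSites (R := R) hN hDsub hι hdist hn
  rw [h0, mul_zero] at h
  exact gffAux_univ_ne_zero (nonpos_iff_eq_zero.1 h)

/-- The mesoscopic scale `⌈n ^ ν⌉`. -/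
def mesoScale (ν : ℝ) (n : ℕ) : ℕ := ⌈(n : ℝ) ^ ν⌉₊

lemma one_le_mesoScale {ν : ℝ} {n : ℕ} (hn : 1 ≤ n) : 1 ≤ mesoScale ν n :=
  Nat.one_le_ceil_iff.2 (Real.rpow_pos_of_pos (by exact_mod_cast hn) _)

lemma eventually_mesoScale_sq_mul_log_sq_le {ν : ℝ} (hν : ν ∈ Set.Ioo (0 : ℝ) 1) (c : ℝ)
    (hc : 0 < c) : ∀ᶠ n : ℕ in atTop,
      c * ((mesoScale ν n : ℝ) ^ 2 * Real.log n ^ 2) ≤ (n : ℝ) ^ 2 := by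
  have h1 := (isLittleO_log_rpow_rpow_atTop 2 (show (0 : ℝ) < 2 - 2 * ν by linarith [hν.2])).bound
    (show 0 < 1 / (4 * c) by positivity)
  filter_upwards [tendsto_natCast_atTop_atTop.eventually h1, eventually_ge_atTop 3] with n hn hn3
  have hpos : (0 : ℝ) < n := by positivity
  have hone : (1 : ℝ) ≤ n := by exact_mod_cast (by omega : 1 ≤ n)
  have hlog := one_le_log_natCast hn3
  rw [Real.norm_of_nonneg (by positivity), Real.norm_of_nonneg (by positivity),
    Real.rpow_two] at hn
  have hL : (mesoScale ν n : ℝ) ≤ 2 * (n : ℝ) ^ ν := by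
    have h2 := Nat.ceil_lt_add_one (Real.rpow_nonneg hpos.le ν)
    have h3 := Real.one_le_rpow hone hν.1.le
    unfold mesoScale
    linarith
  calc c * ((mesoScale ν n : ℝ) ^ 2 * Real.log n ^ 2)
      ≤ c * ((2 * (n : ℝ) ^ ν) ^ 2 * (1 / (4 * c) * (n : ℝ) ^ (2 - 2 * ν))) := by gcongr
    _ = ((n : ℝ) ^ ν) ^ 2 * (n : ℝ) ^ (2 - 2 * ν) := by field_simp; ring
    _ = (n : ℝ) ^ 2 := by
      rw [← Real.rpow_natCast ((n : ℝ) ^ ν), ← Real.rpow_mul hpos.le, ← Real.rpow_add hpos,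
        ← Real.rpow_two]
      congr 1
      push_cast
      ring

lemma lintegral_avoidGff_le {n : ℕ} {X : Finset Site} {R B : ℝ}
    {F : ({x // x ∈ Lam n} → Spin N) → ℝ≥0∞}
    (h : ∫⁻ v in safeSet n N X R, F v ∂(gffAux n N)
      ≤ ENNReal.ofReal B * gffAux n N (safeSet n N X R)) :
    ∫⁻ v, F v ∂(avoidGff n N X R) ≤ ENNReal.ofReal B := by
  rw [avoidGff, lintegral_smul_measure, smul_eq_mul, ← ENNReal.div_eq_inv_mul]
  exact ENNReal.div_le_of_le_mul h

lemma exists_sum_increment_le (hN : 2 ≤ N) (hDsub : D ⊆ unitSq) (hι : 0 < ι)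
    (hdist : ∀ p ∈ D, ∀ q ∈ frontier unitSq, ι ≤ dist p q) (hR : 0 < R) {ν : ℝ}
    (hν : ν ∈ Set.Ioo (0 : ℝ) 1) :
    ∃ C, 0 < C ∧ ∀ᶠ n : ℕ in atTop, ∀ a b : ℕ, a < 2 * mesoScale ν n → b < 2 * mesoScale ν n →
      ∑ x ∈ domSites D n, ∫⁻ v, ENNReal.ofReal (‖extZero n v x
          - extZero n v (x + ((a : ℤ), (b : ℤ)))‖ ^ 2) ∂(avoidGff n N (domSites D n) R)
        ≤ ENNReal.ofReal (C * (n : ℝ) ^ 2 * Real.log n) := by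
  have hpi := Real.pi_pos
  obtain ⟨c, hc, hcost⟩ := exists_avoidCost_le (D := D) (ι := ι) hR
  refine ⟨32 * (32 * π) * 9 * N + 1, by positivity, ?_⟩
  filter_upwards [eventually_mesoScale_sq_mul_log_sq_le hν (c * (256 * π)) (by positivity),
    eventually_ge_atTop 3] with n hn hn3 a b ha hb
  have hlog := one_le_log_natCast hn3
  have hL : (0 : ℝ) < mesoScale ν n := by exact_mod_cast one_le_mesoScale (by omega)
  have hm : ∀ x : Site, Measurable fun v : {x // x ∈ Lam n} → Spin N =>
      ENNReal.ofReal (‖extZero n v x - extZero n v (x + ((a : ℤ), (b : ℤ)))‖ ^ 2) := fun x =>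
    (((measurable_extZero_apply x).sub
      (measurable_extZero_apply (x + ((a : ℤ), (b : ℤ))))).norm.pow_const 2).ennreal_ofReal
  rw [← lintegral_finsetSum _ fun x _ => hm x]
  have hab : (a : ℝ) + b ≤ 4 * mesoScale ν n := by
    have : a + b ≤ 4 * mesoScale ν n := by omega
    exact_mod_cast this
  have key := setLIntegral_increment_le (n := n) (N := N) (X := domSites D n) (R := R)
    (avoidCost_nonneg (D := D) (ι := ι) (R := R) n)
    (t := 1 / (256 * π * (mesoScale ν n : ℝ) ^ 2)) (by positivity)
    (gffAux_univ_le_domSites hN hDsub hι hdist (by omega)) a b (by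
      rw [one_div, inv_mul_le_iff₀ (by positivity)]
      calc ((a : ℝ) + b) ^ 2 * (8 * π) ≤ (4 * mesoScale ν n) ^ 2 * (8 * π) := by gcongr
        _ = _ := by ring)
  refine lintegral_avoidGff_le ?_
  have hcongr : ∀ v : {x // x ∈ Lam n} → Spin N,
      ∑ x ∈ domSites D n,
        ENNReal.ofReal (‖extZero n v x - extZero n v (x + ((a : ℤ), (b : ℤ)))‖ ^ 2)
      = ENNReal.ofReal (∑ x ∈ domSites D n,
          ‖extZero n v (x + ((a : ℤ), (b : ℤ))) - extZero n v x‖ ^ 2) := fun v => by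
    rw [ENNReal.ofReal_sum_of_nonneg fun _ _ => by positivity]
    exact Finset.sum_congr rfl fun x _ => by rw [norm_sub_rev]
  simp only [hcongr]
  refine key.trans ?_
  gcongr
  have hX := card_domSites_le (D := D) (n := n) (by omega)
  have hv := varBound_le hn3
  have hv0 := varBound_pos n
  have hcost' := hcost n hn3
  calc 32 * varBound n * ((domSites D n).card * N)
        + avoidCost D ι R n / (1 / (256 * π * (mesoScale ν n : ℝ) ^ 2))
      ≤ 32 * (32 * π * Real.log n) * (9 * (n : ℝ) ^ 2 * N)
        + c * Real.log n ^ 2 / (1 / (256 * π * (mesoScale ν n : ℝ) ^ 2)) := by gcongr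
    _ = 32 * (32 * π * Real.log n) * (9 * (n : ℝ) ^ 2 * N)
        + c * (256 * π) * ((mesoScale ν n : ℝ) ^ 2 * Real.log n ^ 2) := by
        field_simp
    _ ≤ 32 * (32 * π * Real.log n) * (9 * (n : ℝ) ^ 2 * N) + (n : ℝ) ^ 2 * Real.log n := by
        refine add_le_add le_rfl (hn.trans ?_)
        nlinarith [sq_nonneg (n : ℝ)]
    _ = _ := by ring

lemma eventually_mul_log_sq_mul_le (c : ℝ) (hc : 0 < c) :
    ∀ᶠ n : ℕ in atTop, c * Real.log n ^ 2 * n ≤ (n : ℝ) ^ 2 := by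
  have h1 := (isLittleO_log_rpow_rpow_atTop 2 (show (0 : ℝ) < 1 by norm_num)).bound
    (show 0 < 1 / c by positivity)
  filter_upwards [tendsto_natCast_atTop_atTop.eventually h1, eventually_ge_atTop 3] with n hn hn3
  have hlog := one_le_log_natCast hn3
  rw [Real.norm_of_nonneg (by positivity), Real.norm_of_nonneg (by positivity),
    Real.rpow_two, Real.rpow_one, one_div, ← div_eq_inv_mul, le_div_iff₀ hc] at hn
  nlinarith [(Nat.cast_nonneg n : (0 : ℝ) ≤ n)]

lemma eventually_sum_measure_small_le (hN : 2 ≤ N) (hDsub : D ⊆ unitSq) (hι : 0 < ι)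
    (hdist : ∀ p ∈ D, ∀ q ∈ frontier unitSq, ι ≤ dist p q) (hR : 0 < R) {M δ : ℝ} (hM : 0 < M)
    (hδ : 0 < δ) :
    ∀ᶠ n : ℕ in atTop, ∑ x ∈ domSites D n,
      avoidGff n N (domSites D n) R {v | ‖extZero n v x‖ ≤ M * Real.sqrt (Real.log n)}
        ≤ ENNReal.ofReal (δ * (n : ℝ) ^ 2) := by
  obtain ⟨c, hc, hcost⟩ := exists_avoidCost_le (D := D) (ι := ι) hR
  obtain ⟨r, hr, he⟩ := exists_cutoffEnergy_le (show 0 < 1 / (9 * M ^ 2) by positivity)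
  have he0 := cutoffEnergy_pos hr
  set e := cutoffEnergy r
  set V := (volume (Metric.ball (0 : Spin N) R)).toReal / (∫⁻ z : Spin N, radialWeight e z).toReal
  have hV : 0 < V := div_pos
    (ENNReal.toReal_pos (Metric.measure_ball_pos volume _ hR).ne' measure_ball_lt_top.ne)
    (lintegral_radialWeight_toReal_pos he0)
  have hS : Tendsto (fun n : ℕ => M * Real.sqrt (Real.log n)) atTop atTop :=
    (tendsto_sqrt_atTop.comp (Real.tendsto_log_atTop.comp tendsto_natCast_atTop_atTop)).const_mul_atTop
      hM
  have hrn : ∀ᶠ n : ℕ in atTop, (r : ℝ) ≤ ι * n :=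
    (tendsto_natCast_atTop_atTop.const_mul_atTop hι).eventually_ge_atTop _
  filter_upwards [hS.eventually (exists_tail_radialWeight_le (E := Spin N) he0
      (show 0 < δ / 36 by positivity)), hS.eventually_ge_atTop R, hrn,
    eventually_mul_log_sq_mul_le (2 * r ^ 2 * c / V / δ) (by positivity),
    eventually_ge_atTop 3] with n htail hSR hrn hbig hn3
  have hlog := one_le_log_natCast hn3
  have hn1 : 1 ≤ n := by omega
  have hpos : (0 : ℝ) < n := by positivity
  have key := sum_measure_small_le (n := n) (N := N) (X := domSites D n) hr hR (by positivity)
    (by positivity) (avoidCost_nonneg (D := D) (ι := ι) (R := R) n) htail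
    (gffAux_univ_le_domSites hN hDsub hι hdist hn1)
    (fun x hx => isDeep_of_mem_Dn hDsub hdist hn1 hrn (Finset.mem_filter.1 hx).2)
  set S := M * Real.sqrt (Real.log n) with hSdef
  have hball : V / n ≤ ballMass (Spin N) e R S := by
    have h1 : e * (2 * S + R) ^ 2 ≤ Real.log n := by
      calc e * (2 * S + R) ^ 2 ≤ 1 / (9 * M ^ 2) * (3 * S) ^ 2 := by
            gcongr
            linarith
        _ = Real.sqrt (Real.log n) ^ 2 := by rw [hSdef]; field_simp; ring
        _ = _ := Real.sq_sqrt (by linarith)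
    have h2 : (n : ℝ)⁻¹ ≤ Real.exp (-(e * (2 * S + R) ^ 2)) := by
      rw [← Real.exp_log hpos, ← Real.exp_neg]
      simpa using h1
    exact mul_le_mul_of_nonneg_left h2 hV.le
  have hX := card_domSites_le (D := D) (n := n) hn1
  calc ∑ x ∈ domSites D n, avoidGff n N (domSites D n) R {v | ‖extZero n v x‖ ≤ S}
      = (gffAux n N (safeSet n N (domSites D n) R))⁻¹ * ∑ x ∈ domSites D n,
          gffAux n N (safeSet n N (domSites D n) R ∩ {v | ‖extZero n v x‖ ≤ S}) := by
        rw [Finset.mul_sum]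
        refine Finset.sum_congr rfl fun x _ => ?_
        rw [avoidGff, Measure.smul_apply, smul_eq_mul,
          Measure.restrict_apply (measurableSet_norm_extZero_le x S), Set.inter_comm]
    _ ≤ ENNReal.ofReal (2 * (δ / 36) * (domSites D n).card
          + r ^ 2 * (avoidCost D ι R n / ballMass (Spin N) e R S)) := by
        rw [← ENNReal.div_eq_inv_mul]
        exact ENNReal.div_le_of_le_mul key
    _ ≤ _ := by
        gcongr
        calc _ ≤ 2 * (δ / 36) * (9 * (n : ℝ) ^ 2) + r ^ 2 * (c * Real.log n ^ 2 / (V / n)) := by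
              gcongr
              exact hcost n hn3
          _ = 2 * (δ / 36) * (9 * (n : ℝ) ^ 2)
              + δ / 2 * (2 * r ^ 2 * c / V / δ * Real.log n ^ 2 * n) := by
              field_simp
          _ ≤ 2 * (δ / 36) * (9 * (n : ℝ) ^ 2) + δ / 2 * (n : ℝ) ^ 2 := by gcongr
          _ = _ := by ring

end Asymptotics

section Freezing

/-- The conditional spin correlations are at least `1 - ε` on `T`, up to distance `n ^ ν`. -/
def IsFrozen (N : ℕ) (D : Set (ℝ × ℝ)) (R ν ε : ℝ) (n : ℕ) (T : Set Site) : Prop :=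
  ∀ x ∈ T, ∀ y ∈ T,
    Real.sqrt (((x.1 - y.1 : ℤ) : ℝ) ^ 2 + ((x.2 - y.2 : ℤ) : ℝ) ^ 2) ≤ (n : ℝ) ^ ν →
    1 - ε ≤ condExpOn (gff n N) (avoids (Dn D n) (Metric.ball (0 : Spin N) R))
      (fun φ => (inner ℝ ((‖φ x‖)⁻¹ • φ x) ((‖φ y‖)⁻¹ • φ y) : ℝ))

variable {N : ℕ} {D : Set (ℝ × ℝ)} {ι R : ℝ}

lemma abs_sub_le_mesoScale {ν : ℝ} {n : ℕ} {a b : ℤ}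
    (h : Real.sqrt ((a : ℝ) ^ 2 + (b : ℝ) ^ 2) ≤ (n : ℝ) ^ ν) :
    |a| ≤ mesoScale ν n ∧ |b| ≤ mesoScale ν n := by
  have h1 : Real.sqrt ((a : ℝ) ^ 2 + (b : ℝ) ^ 2) ≤ mesoScale ν n := h.trans (Nat.le_ceil _)
  have h2 : |(a : ℝ)| ≤ mesoScale ν n :=
    (Real.abs_le_sqrt (le_add_of_nonneg_right (sq_nonneg _))).trans h1
  have h3 : |(b : ℝ)| ≤ mesoScale ν n :=
    (Real.abs_le_sqrt (le_add_of_nonneg_left (sq_nonneg _))).trans h1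
  exact ⟨by exact_mod_cast h2, by exact_mod_cast h3⟩

lemma eventually_exists_isFrozen (hN : 2 ≤ N) (hDsub : D ⊆ unitSq) (hι : 0 < ι)
    (hdist : ∀ p ∈ D, ∀ q ∈ frontier unitSq, ι ≤ dist p q) (hR : 0 < R) {ν ε δ : ℝ}
    (hν : ν ∈ Set.Ioo (0 : ℝ) 1) (hε : 0 < ε) (hδ : 0 < δ) :
    ∀ᶠ n : ℕ in atTop, ∃ T ⊆ Dn D n, IsFrozen N D R ν ε n T ∧
      ((Dn D n \ T).ncard : ℝ) ≤ δ * (n : ℝ) ^ 2 := by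
  obtain ⟨C, hC, hinc⟩ := exists_sum_increment_le hN hDsub hι hdist hR hν
  set K := 2 * C / δ with hK
  have hK0 : 0 < K := by positivity
  set M := Real.sqrt (64 * K / ε) with hM
  have hM0 : 0 < M := Real.sqrt_pos.2 (by positivity)
  have hM2 : M ^ 2 = 64 * K / ε := Real.sq_sqrt (by positivity)
  filter_upwards [hinc, eventually_sum_measure_small_le hN hDsub hι hdist hR hM0
    (show 0 < δ * ε / 8 by positivity), eventually_ge_atTop 3] with n hinc hsmall hn3
  have hn1 : 1 ≤ n := by omega
  have hlog : 0 < Real.log n := zero_lt_one.trans_le (one_le_log_natCast hn3)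
  set L := mesoScale ν n with hL
  have hL1 : 1 ≤ L := one_le_mesoScale hn1
  have hL0 : (0 : ℝ) < L := by exact_mod_cast hL1
  set X := domSites D n
  have hX : (X : Set Site) = Dn D n := coe_domSites hDsub hι hdist hn1
  set Q := avoidGff n N X R with hQ
  have hQp : IsProbabilityMeasure Q :=
    isProbabilityMeasure_avoidGff (gffAux_safeSet_ne_zero hN hDsub hι hdist hn1)
  set S := M * Real.sqrt (Real.log n) with hS
  have hS0 : 0 < S := mul_pos hM0 (Real.sqrt_pos.2 hlog)
  set A : Site → Site → ℝ≥0∞ := fun x y =>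
    ∫⁻ v, ENNReal.ofReal (‖extZero n v x - extZero n v y‖ ^ 2) ∂Q with hA
  have hAtri : ∀ x y z, A x y ≤ 2 * A x z + 2 * A y z := by
    intro x y z
    have hm : ∀ a b : Site, Measurable fun v : {x // x ∈ Lam n} → Spin N =>
        ENNReal.ofReal (‖extZero n v a - extZero n v b‖ ^ 2) := fun a b =>
      (((measurable_extZero_apply a).sub
        (measurable_extZero_apply b)).norm.pow_const 2).ennreal_ofReal
    rw [hA]
    simp only
    rw [← lintegral_const_mul _ (hm x z), ← lintegral_const_mul _ (hm y z),
      ← lintegral_add_left ((hm x z).const_mul _)]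
    refine lintegral_mono fun v => ?_
    simp only
    rw [two_mul_ofReal, two_mul_ofReal, ← ENNReal.ofReal_add (by positivity) (by positivity)]
    refine ENNReal.ofReal_le_ofReal ?_
    have h1 := norm_sub_le_norm_sub_add_norm_sub (extZero n v x) (extZero n v z) (extZero n v y)
    rw [norm_sub_rev (extZero n v z)] at h1
    nlinarith [sq_nonneg (‖extZero n v x - extZero n v z‖ - ‖extZero n v y - extZero n v z‖),
      norm_nonneg (extZero n v x - extZero n v y)]
  set W := Finset.range (2 * L) ×ˢ Finset.range (2 * L) with hW
  set a : Site → ℝ≥0∞ := fun x => ∑ h ∈ W, A x (x + ((h.1 : ℤ), (h.2 : ℤ))) with ha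
  set b : Site → ℝ≥0∞ := fun x => Q {v | ‖extZero n v x‖ ≤ S} with hb
  have hsuma : ∑ x ∈ X, a x ≤ ENNReal.ofReal (4 * L ^ 2 * (C * (n : ℝ) ^ 2 * Real.log n)) := by
    rw [ha, Finset.sum_comm]
    calc _ ≤ W.card • ENNReal.ofReal (C * (n : ℝ) ^ 2 * Real.log n) :=
          Finset.sum_le_card_nsmul _ _ _ fun h hh => by
            rw [hW, Finset.mem_product, Finset.mem_range, Finset.mem_range] at hh
            exact hinc h.1 h.2 hh.1 hh.2
      _ = _ := by
          rw [nsmul_eq_mul, ← ENNReal.ofReal_natCast, ← ENNReal.ofReal_mul (by positivity), hW,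
            Finset.card_product, Finset.card_range]
          congr 2
          push_cast
          ring
  set Ka := 4 * (L : ℝ) ^ 2 * (K * Real.log n) with hKa
  set Fa := X.filter fun x => ENNReal.ofReal Ka < a x
  set Fb := X.filter fun x => ENNReal.ofReal (ε / 4) < b x
  have hFa : (Fa.card : ℝ) ≤ δ / 2 * (n : ℝ) ^ 2 := by
    have h1 : (Fa.card : ℝ) * Ka ≤ _ := card_filter_lt_mul_le X a (by positivity) hsuma
    have h2 : 4 * (L : ℝ) ^ 2 * (C * (n : ℝ) ^ 2 * Real.log n) = δ / 2 * (n : ℝ) ^ 2 * Ka := by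
      rw [hKa, hK]
      field_simp
    rw [h2] at h1
    exact le_of_mul_le_mul_right h1 (by positivity)
  have hFb : (Fb.card : ℝ) ≤ δ / 2 * (n : ℝ) ^ 2 := by
    have h1 : (Fb.card : ℝ) * (ε / 4) ≤ _ := card_filter_lt_mul_le X b (by positivity) hsmall
    have h2 : δ * ε / 8 * (n : ℝ) ^ 2 = δ / 2 * (n : ℝ) ^ 2 * (ε / 4) := by ring
    rw [h2] at h1
    exact le_of_mul_le_mul_right h1 (by positivity)
  refine ⟨(X \ (Fa ∪ Fb) : Finset Site), ?_, ?_, ?_⟩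
  · rw [← hX, Finset.coe_subset]
    exact Finset.sdiff_subset
  · intro x hx y hy hxy
    simp only [Finset.coe_sdiff, Set.mem_sdiff, Finset.mem_coe, Finset.mem_union, not_or, Fa, Fb,
      Finset.mem_filter, not_and, not_lt] at hx hy
    obtain ⟨hxX, hxa, hxb⟩ := hx
    obtain ⟨hyX, hya, -⟩ := hy
    obtain ⟨d1, d2⟩ := abs_sub_le_mesoScale hxy
    have hKa' : ENNReal.ofReal Ka = 4 * (L : ℝ≥0∞) ^ 2 * ENNReal.ofReal (K * Real.log n) := by
      rw [hKa, ENNReal.ofReal_mul (by positivity), ENNReal.ofReal_mul (by positivity),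
        ENNReal.ofReal_pow (by positivity), ENNReal.ofReal_natCast, ENNReal.ofReal_ofNat]
    have hxy' : A x y ≤ ENNReal.ofReal (16 * (K * Real.log n)) := by
      rw [ENNReal.ofReal_mul (by positivity), ENNReal.ofReal_ofNat]
      exact le_of_window_sum_le hAtri hL1 d1 d2 ((hxa hxX).trans_eq hKa') ((hya hyX).trans_eq hKa')
    have hmain := le_integral_inner_normalize (Q := Q) (measurable_extZero_apply x)
      (measurable_extZero_apply y) hS0 (by positivity) (by positivity) hxy' (hxb hxX)
    have hS2 : S ^ 2 = 64 * K / ε * Real.log n := by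
      rw [hS, mul_pow, hM2, Real.sq_sqrt hlog.le]
    have hval : 2 / S ^ 2 * (16 * (K * Real.log n)) + 2 * (ε / 4) = ε := by
      rw [hS2]
      field_simp
      norm_num
    rw [hval] at hmain
    rw [← hX, condExpOn_gff_avoids]
    · exact hmain
    · exact ((measurable_pi_apply x).norm.inv.smul (measurable_pi_apply x)).inner
        ((measurable_pi_apply y).norm.inv.smul (measurable_pi_apply y))
  · rw [← hX, ← Finset.coe_sdiff, Set.ncard_coe_finset]
    have h1 : (X \ (X \ (Fa ∪ Fb))).card ≤ Fa.card + Fb.card := by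
      refine (Finset.card_le_card ?_).trans (Finset.card_union_le _ _)
      intro x
      simp only [Finset.mem_sdiff]
      tauto
    calc ((X \ (X \ (Fa ∪ Fb))).card : ℝ) ≤ Fa.card + Fb.card := by exact_mod_cast h1
      _ ≤ δ / 2 * (n : ℝ) ^ 2 + δ / 2 * (n : ℝ) ^ 2 := add_le_add hFa hFb
      _ = _ := by ring

/-- A sequence of frozen sets with the fewest missing sites. -/
lemma exists_minimal_isFrozen (N : ℕ) (D : Set (ℝ × ℝ)) (R ν ε : ℝ) (n : ℕ) :
    ∃ T ⊆ Dn D n, IsFrozen N D R ν ε n T ∧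
      ∀ T' ⊆ Dn D n, IsFrozen N D R ν ε n T' → (Dn D n \ T).ncard ≤ (Dn D n \ T').ncard := by
  obtain ⟨T, ⟨hT, hT'⟩, hmin⟩ := WellFounded.has_min
    (measure fun T : Set Site => (Dn D n \ T).ncard).wf
    {T | T ⊆ Dn D n ∧ IsFrozen N D R ν ε n T} ⟨∅, Set.empty_subset _, fun _ h => h.elim⟩
  exact ⟨T, hT, hT', fun T' h1 h2 => not_lt.1 (hmin T' ⟨h1, h2⟩)⟩

end Freezing

/-- **Theorem (freezing of spins at mesoscopic scales, `N ≥ 2`).**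
For `I = B^N(0,R)`, `ν ∈ (0,1)` and `ε > 0`, for all large `n` there is `D̃_n ⊆ D_n`
with `|D_n \ D̃_n| = o(n²)` such that for all `x, y ∈ D̃_n` with `|x - y| ≤ n^ν`,
`E_n[ (φ(x)/|φ(x)|) ⬝ (φ(y)/|φ(y)|) | Ω^I_{D_n} ] ≥ 1 - ε`. -/
theorem freezing_mesoscopic (N : ℕ) (hN : 2 ≤ N)
    (D : Set (ℝ × ℝ)) (hDopen : IsOpen D) (hD0 : (0, 0) ∈ D) (hDsub : D ⊆ unitSq)
    (ι : ℝ) (hι : 0 < ι) (hdist : ∀ p ∈ D, ∀ q ∈ frontier unitSq, ι ≤ dist p q)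
    (R : ℝ) (hR : 0 < R) (ν ε : ℝ) (hν : ν ∈ Set.Ioo (0 : ℝ) 1) (hε : 0 < ε) :
    ∃ Dt : ℕ → Set Site,
      (∀ n, Dt n ⊆ Dn D n) ∧
      Tendsto (fun n : ℕ => ((Dn D n \ Dt n).ncard : ℝ) / (n : ℝ) ^ 2) atTop (nhds 0) ∧
      ∀ᶠ n : ℕ in atTop, ∀ x ∈ Dt n, ∀ y ∈ Dt n,
        Real.sqrt (((x.1 - y.1 : ℤ) : ℝ) ^ 2 + ((x.2 - y.2 : ℤ) : ℝ) ^ 2) ≤ (n : ℝ) ^ ν →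
        1 - ε ≤
          condExpOn (gff n N) (avoids (Dn D n) (Metric.ball (0 : Spin N) R))
            (fun φ => (inner ℝ ((‖φ x‖)⁻¹ • φ x) ((‖φ y‖)⁻¹ • φ y) : ℝ)) := by
  choose Dt hsub hfrozen hmin using exists_minimal_isFrozen N D R ν ε
  refine ⟨Dt, hsub, ?_, Eventually.of_forall hfrozen⟩
  rw [Metric.tendsto_nhds]
  intro δ hδ
  filter_upwards [eventually_exists_isFrozen hN hDsub hι hdist hR hν hε (half_pos hδ),
    eventually_ge_atTop 1] with n ⟨T, hT, hTf, hcard⟩ hn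
  have hpos : (0 : ℝ) < n := by exact_mod_cast hn
  have h1 : ((Dn D n \ Dt n).ncard : ℝ) ≤ δ / 2 * (n : ℝ) ^ 2 :=
    (Nat.cast_le.2 (hmin n T hT hTf)).trans hcard
  rw [Real.dist_eq, sub_zero, abs_of_nonneg (by positivity), div_lt_iff₀ (by positivity)]
  nlinarith [mul_pos hδ (pow_pos hpos 2)]

end
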